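/- Let d ≥ 1 be an integer and let A ⊆ [0,d] be a nonempty analytic set that contains its infimum and its supremum. Then there exists a compact set K ⊆ ℝ^d such that every microset E of K satisfies dim_H E = \overline{dim}_B E (Hausdorff dimension equals upper box dimension), and {dim_H E : E is a microset of K} = A. -/

import Mathlib

open Filter MeasureTheory Set
open scoped ENNReal

/-- `E` is a microset of the compact set `K ⊆ ℝ^d`. -/
def IsMicroset (d : ℕ) (K E : Set (Fin d → ℝ)) : Prop :=
  IsCompact E ∧ E ⊆ Set.univ.pi (fun _ => Set.Icc (0 : ℝ) 1) ∧
  (E ∩ Set.univ.pi (fun _ => Set.Ioo (0 : ℝ) 1)).Nonempty ∧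
  ∃ (lam : ℕ → ℝ) (u : ℕ → Fin d → ℝ), (∀ n, 1 ≤ lam n) ∧
    Filter.Tendsto
      (fun n => EMetric.hausdorffEdist
        (((fun z => lam n • z + u n) '' K) ∩ Set.univ.pi (fun _ => Set.Icc (0 : ℝ) 1)) E)
      Filter.atTop (nhds 0)

/-- `N_n(s)`: the minimal number of closed balls of radius `2^{-n}` needed to cover `s`. -/
noncomputable def coverNum {X : Type*} [MetricSpace X] (s : Set X) (n : ℕ) : ℕ :=
  sInf {m : ℕ | ∃ t : Finset X, t.card = m ∧
    s ⊆ ⋃ y ∈ t, Metric.closedBall y ((2 : ℝ) ^ (-(n : ℤ)))}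

/-- Upper box dimension: `limsup_n log N_n(s) / (n log 2)`. -/
noncomputable def ubDim {X : Type*} [MetricSpace X] (s : Set X) : ℝ≥0∞ :=
  Filter.limsup
    (fun n : ℕ => ENNReal.ofReal (Real.log (coverNum s n) / (n * Real.log 2)))
    Filter.atTop

namespace Micro

def Avg (f : ℕ → ℝ) (l : ℝ) : Prop :=
  Tendsto (fun N : ℕ => (∑ m ∈ Finset.range N, f m) / N) atTop (nhds l)

lemma Avg.perturb {f g h : ℕ → ℝ} {l C : ℝ} (hg : Avg g l) (hh : Avg h 0)
    (H : ∀ N, |∑ m ∈ Finset.range N, f m - ∑ m ∈ Finset.range N, g m|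
      ≤ C + ∑ m ∈ Finset.range N, h m) : Avg f l := by
  unfold Avg at *
  have h1 : Tendsto (fun N : ℕ => C / (N:ℝ) + (∑ m ∈ Finset.range N, h m) / N) atTop (nhds 0) := by
    simpa using (tendsto_const_div_atTop_nhds_zero_nat C).add hh
  have h2 : Tendsto (fun N : ℕ => (∑ m ∈ Finset.range N, f m) / (N:ℝ)
      - (∑ m ∈ Finset.range N, g m) / N) atTop (nhds 0) := by
    apply squeeze_zero_norm _ h1
    intro N
    rw [← sub_div, ← add_div, Real.norm_eq_abs, abs_div, Nat.abs_cast]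
    gcongr
    exact H N
  simpa using h2.add hg

lemma Avg.const (c : ℝ) : Avg (fun _ => c) c := by
  unfold Avg
  apply tendsto_const_nhds.congr'
  filter_upwards [eventually_gt_atTop 0] with N hN
  have : (N:ℝ) ≠ 0 := by positivity
  simp; field_simp

lemma shift_bound {f : ℕ → ℝ} (hf : ∀ n, |f n| ≤ 1) (c N : ℕ) :
    |∑ m ∈ Finset.range N, f (m + c) - ∑ m ∈ Finset.range N, f m| ≤ 2 * c := by
  induction c with
  | zero => simp
  | succ c ih =>
    have e : ∑ m ∈ Finset.range N, f (m + (c+1)) - ∑ m ∈ Finset.range N, f (m + c)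
        = f (N + c) - f (0 + c) := by
      rw [← Finset.sum_range_sub (fun m => f (m + c)) N, ← Finset.sum_sub_distrib]
      apply Finset.sum_congr rfl
      intro m _
      congr 2; ring
    have h1 := abs_le.1 (hf (N + c))
    have h2 := abs_le.1 (hf (0 + c))
    rw [abs_le] at *
    push_cast
    constructor <;> linarith

lemma avg_shift {f : ℕ → ℝ} (hf : ∀ n, |f n| ≤ 1) (c : ℕ) {l : ℝ} :
    Avg (fun m => f (m + c)) l ↔ Avg f l := by
  constructor
  · intro h
    refine h.perturb (Avg.const 0) (C := 2 * c) ?_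
    intro N
    rw [abs_sub_comm]
    simpa using shift_bound hf c N
  · intro h
    refine h.perturb (Avg.const 0) (C := 2 * c) ?_
    intro N
    simpa using shift_bound hf c N

noncomputable def val (a b : ℝ) (t : Bool) : ℝ := if t then b else a
noncomputable def bv (t : Bool) : ℝ := if t then 1 else 0
noncomputable def chg (θ : ℕ → Bool) (m : ℕ) : ℝ := if θ m = θ (m+1) then 0 else 1

def Good (a b : ℝ) (θ : ℕ → Bool) (α : ℝ) : Prop :=
  Avg (fun m => val a b (θ m)) α ∧ Avg (chg θ) 0

lemma abs_chg (θ : ℕ → Bool) (m : ℕ) : |chg θ m| ≤ 1 := by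
  unfold chg; split_ifs <;> simp

lemma chg_nonneg (θ : ℕ → Bool) (m : ℕ) : 0 ≤ chg θ m := by
  unfold chg; split_ifs <;> simp

lemma abs_val {a b : ℝ} (ha : a ∈ Icc (0:ℝ) 1) (hb : b ∈ Icc (0:ℝ) 1) (t : Bool) :
    |val a b t| ≤ 1 := by
  unfold val
  rw [abs_le]
  split_ifs <;> constructor <;> linarith [ha.1, ha.2, hb.1, hb.2]

lemma good_shift {a b : ℝ} (ha : a ∈ Icc (0:ℝ) 1) (hb : b ∈ Icc (0:ℝ) 1) (c : ℕ) {θ : ℕ → Bool}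
    {α : ℝ} : Good a b (fun m => θ (m + c)) α ↔ Good a b θ α := by
  have h1 := avg_shift (f := fun m => val a b (θ m)) (fun n => abs_val ha hb _) c (l := α)
  have h2 := avg_shift (f := chg θ) (abs_chg θ) c (l := 0)
  have e : (fun m => chg θ (m + c)) = chg (fun m => θ (m + c)) := by
    funext m
    unfold chg
    congr 3; ring
  rw [e] at h2
  exact and_congr h1 h2

lemma good_const {a b : ℝ} (t : Bool) : Good a b (fun _ => t) (val a b t) := by
  refine ⟨Avg.const _, ?_⟩
  have : chg (fun _ => t) = fun _ => 0 := by funext; simp [chg]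
  rw [this]; exact Avg.const 0

/-- balanced digit -/
noncomputable def rot (c : ℝ) (k : ℕ) : Bool := decide (⌊c * k⌋ < ⌊c * (k+1)⌋)

lemma bv_rot {c : ℝ} (hc : c ∈ Icc (0:ℝ) 1) (k : ℕ) :
    bv (rot c k) - c = Int.fract (c * k) - Int.fract (c * (k+1)) := by
  have h1 : ⌊c * k⌋ ≤ ⌊c * (k+1)⌋ := Int.floor_mono (by nlinarith [hc.1])
  have h2 : ⌊c * (k+1)⌋ ≤ ⌊c * k⌋ + 1 := by
    rw [← Int.floor_add_one]
    exact Int.floor_mono (by nlinarith [hc.2])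
  have h3 := Int.floor_add_fract (c * k)
  have h4 := Int.floor_add_fract (c * (k+1))
  unfold bv rot
  by_cases h : ⌊c * k⌋ < ⌊c * (k+1)⌋
  · have : ⌊c * (k+1)⌋ = ⌊c * k⌋ + 1 := by omega
    rw [this] at h4
    push_cast at h4
    simp [h]; linarith
  · have : ⌊c * (k+1)⌋ = ⌊c * k⌋ := by omega
    rw [this] at h4
    simp [h]; linarith

noncomputable def digs (a b : ℝ) (τ : ℕ → Bool) (k : ℕ) : Bool := rot (val a b (τ k)) k

lemma window {a b : ℝ} (ha : a ∈ Icc (0:ℝ) 1) (hb : b ∈ Icc (0:ℝ) 1) (τ : ℕ → Bool) (k N : ℕ) :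
    |∑ m ∈ Finset.range N, bv (digs a b τ (k + m)) - ∑ m ∈ Finset.range N, val a b (τ (k+m))|
      ≤ 1 + ∑ m ∈ Finset.range N, chg (fun m => τ (k+m)) m := by
  have hv : ∀ t, val a b t ∈ Icc (0:ℝ) 1 := by
    intro t; unfold val; split_ifs <;> assumption
  have key : |∑ m ∈ Finset.range N, bv (digs a b τ (k + m))
      - ∑ m ∈ Finset.range N, val a b (τ (k+m)) - Int.fract (val a b (τ k) * k)
        + Int.fract (val a b (τ (k+N)) * ((k + N : ℕ):ℝ))|
      ≤ ∑ m ∈ Finset.range N, chg (fun m => τ (k+m)) m := by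
    induction N with
    | zero => simp
    | succ N ih =>
      rw [Finset.sum_range_succ, Finset.sum_range_succ, Finset.sum_range_succ]
      have h1 := bv_rot (hv (τ (k+N))) (k+N)
      have h2 : |Int.fract (val a b (τ (k+N+1)) * ((k + N + 1 : ℕ):ℝ))
          - Int.fract (val a b (τ (k+N)) * ((k + N + 1 : ℕ):ℝ))| ≤ chg (fun m => τ (k+m)) N := by
        unfold chg
        by_cases h : τ (k+N) = τ (k+(N+1))
        · rw [if_pos h, add_assoc, h]; simp
        · rw [if_neg h, abs_le]
          constructor <;>
          linarith [Int.fract_nonneg (val a b (τ (k+N+1)) * ((k + N + 1 : ℕ):ℝ)),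
            Int.fract_nonneg (val a b (τ (k+N)) * ((k + N + 1 : ℕ):ℝ)),
            Int.fract_lt_one (val a b (τ (k+N+1)) * ((k + N + 1 : ℕ):ℝ)),
            Int.fract_lt_one (val a b (τ (k+N)) * ((k + N + 1 : ℕ):ℝ))]
      have e : digs a b τ (k+N) = rot (val a b (τ (k+N))) (k+N) := rfl
      rw [← add_assoc, e]
      push_cast at *
      rw [abs_le] at *
      constructor <;> linarith
  have h1 := Int.fract_nonneg (val a b (τ k) * k)
  have h2 := Int.fract_lt_one (val a b (τ k) * k)
  have h3 := Int.fract_nonneg (val a b (τ (k+N)) * ((k + N : ℕ):ℝ))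
  have h4 := Int.fract_lt_one (val a b (τ (k+N)) * ((k + N : ℕ):ℝ))
  rw [abs_le] at *
  constructor <;> linarith

lemma freq_of_good {a b : ℝ} (ha : a ∈ Icc (0:ℝ) 1) (hb : b ∈ Icc (0:ℝ) 1) {τ : ℕ → Bool}
    {U : Filter ℕ} [U.NeBot] {k : ℕ → ℕ} {η θ : ℕ → Bool} {α : ℝ}
    (hη : ∀ m, ∀ᶠ n in U, digs a b τ (k n + m) = η m)
    (hθ : ∀ m, ∀ᶠ n in U, τ (k n + m) = θ m) (hg : Good a b θ α) :
    Avg (fun m => bv (η m)) α := by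
  refine hg.1.perturb hg.2 (C := 1) ?_
  intro N
  have h1 : ∀ᶠ n in U, ∀ m ∈ Finset.range (N+1), digs a b τ (k n + m) = η m :=
    (Filter.eventually_all_finset _).2 fun m _ => hη m
  have h2 : ∀ᶠ n in U, ∀ m ∈ Finset.range (N+1), τ (k n + m) = θ m :=
    (Filter.eventually_all_finset _).2 fun m _ => hθ m
  obtain ⟨n, hn1, hn2⟩ := (h1.and h2).exists
  have := window ha hb τ (k n) N
  have e1 : ∑ m ∈ Finset.range N, bv (digs a b τ (k n + m)) = ∑ m ∈ Finset.range N, bv (η m) := by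
    apply Finset.sum_congr rfl
    intro m hm
    rw [hn1 m (by simp at *; omega)]
  have e2 : ∑ m ∈ Finset.range N, val a b (τ (k n + m))
      = ∑ m ∈ Finset.range N, val a b (θ m) := by
    apply Finset.sum_congr rfl
    intro m hm
    rw [hn2 m (by simp at *; omega)]
  have e3 : ∑ m ∈ Finset.range N, chg (fun m => τ (k n + m)) m
      = ∑ m ∈ Finset.range N, chg θ m := by
    apply Finset.sum_congr rfl
    intro m hm
    unfold chg
    simp at hm
    simp only [hn2 m (by simp; omega), hn2 (m+1) (by simp; omega)]
  rwa [e1, e2, e3] at this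

end Micro

namespace Micro

noncomputable def V (a b : ℝ) (g : ℕ → ℝ) : ℕ → ℝ
  | 0 => 0
  | j+1 => V a b g j + (2*j+1) * val a b (decide (V a b g j ≤ j^2 * g j))

noncomputable def ty (a b : ℝ) (g : ℕ → ℝ) (j : ℕ) : Bool := decide (V a b g j ≤ j^2 * g j)

noncomputable def word (a b : ℝ) (g : ℕ → ℝ) (t : ℕ) : Bool := ty a b g (Nat.sqrt t)

lemma V_succ (a b : ℝ) (g : ℕ → ℝ) (j : ℕ) :
    V a b g (j+1) = V a b g j + (2*j+1) * val a b (ty a b g j) := rfl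

lemma V_congr {a b : ℝ} {g g' : ℕ → ℝ} (j : ℕ) (h : ∀ i < j, g i = g' i) :
    V a b g j = V a b g' j := by
  induction j with
  | zero => rfl
  | succ j ih =>
    have := ih (fun i hi => h i (by omega))
    rw [V, V, this, h j (by omega)]

lemma word_congr {a b : ℝ} {g g' : ℕ → ℝ} (t : ℕ) (h : ∀ i ≤ t, g i = g' i) :
    word a b g t = word a b g' t := by
  have h1 := Nat.sqrt_le_self t
  unfold word ty
  rw [V_congr (Nat.sqrt t) (fun i hi => h i (by omega)), h _ h1]

lemma V_upper {a b G ε : ℝ} {g : ℕ → ℝ} (hb : b ≤ 1)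
    (hG : 0 ≤ G) (hε : 0 < ε) (haG : a ≤ G) {J : ℕ} (hJ : ∀ j ≥ J, g j ≤ G + ε) :
    ∃ C, ∀ j ≥ J, V a b g j ≤ j^2 * (G+ε) + C + 2*j := by
  refine ⟨|V a b g J|, ?_⟩
  intro j hj
  induction j, hj using Nat.le_induction with
  | base =>
    have := le_abs_self (V a b g J)
    have h2 : 0 ≤ (J:ℝ)^2 * (G+ε) := by positivity
    have h3 : (0:ℝ) ≤ J := by positivity
    linarith
  | succ j hj ih =>
    rw [V_succ]
    have h0 := abs_nonneg (V a b g J)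
    have h3 : (0:ℝ) ≤ j := by positivity
    unfold ty val
    by_cases h : V a b g j ≤ j^2 * g j
    · simp only [h, decide_true, if_true]
      have h4 : (j:ℝ)^2 * g j ≤ j^2 * (G+ε) := by gcongr; exact hJ j hj
      push_cast
      nlinarith
    · simp only [h, decide_false, Bool.false_eq_true, if_false]
      push_cast
      nlinarith

lemma V_lower {a b G ε : ℝ} {g : ℕ → ℝ} (ha : 0 ≤ a)
    (hG : G ≤ 1) (hε : 0 < ε) (haG : G ≤ b) {J : ℕ} (hJ : ∀ j ≥ J, G - ε ≤ g j) :
    ∃ C, ∀ j ≥ J, j^2 * (G-ε) - C - 2*j ≤ V a b g j := by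
  refine ⟨|V a b g J| + J^2, ?_⟩
  intro j hj
  induction j, hj using Nat.le_induction with
  | base =>
    have := neg_abs_le (V a b g J)
    have h2 : (J:ℝ)^2 * (G-ε) ≤ J^2 * 1 := by gcongr; linarith
    have h3 : (0:ℝ) ≤ J := by positivity
    linarith
  | succ j hj ih =>
    rw [V_succ]
    have h0 := abs_nonneg (V a b g J)
    have h3 : (0:ℝ) ≤ j := by positivity
    have h5 : (0:ℝ) ≤ (J:ℝ)^2 := by positivity
    unfold ty val
    by_cases h : V a b g j ≤ j^2 * g j
    · simp only [h, decide_true, if_true]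
      push_cast
      nlinarith
    · simp only [h, decide_false, Bool.false_eq_true, if_false]
      have h4 : (j:ℝ)^2 * (G-ε) ≤ j^2 * g j := by gcongr; exact hJ j hj
      push_cast
      nlinarith

lemma sum_word_sq (a b : ℝ) (g : ℕ → ℝ) (j i : ℕ) (hi : i ≤ 2*j+1) :
    ∑ m ∈ Finset.range (j*j+i), val a b (word a b g m) = V a b g j + i * val a b (ty a b g j) := by
  induction j generalizing i with
  | zero =>
    have : i = 0 ∨ i = 1 := by omega
    rcases this with rfl | rfl
    · simp [V]
    · simp [V, word]
  | succ j ih =>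
    induction i with
    | zero =>
      have := ih (2*j+1) le_rfl
      rw [show (j+1)*(j+1)+0 = j*j+(2*j+1) by ring, this, V_succ]
      push_cast; ring
    | succ i ih2 =>
      rw [← add_assoc, Finset.sum_range_succ, ih2 (by omega)]
      have : Nat.sqrt ((j+1)*(j+1)+i) = j+1 := by
        apply Nat.sqrt_add_eq; omega
      rw [word, this]; push_cast; ring

lemma tendsto_sqrt_div : Tendsto (fun N : ℕ => (Nat.sqrt N : ℝ) / N) atTop (nhds 0) := by
  have h : Tendsto (fun N : ℕ => 1 / Real.sqrt N) atTop (nhds 0) := by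
    simp only [one_div]
    exact tendsto_inv_atTop_zero.comp (Real.tendsto_sqrt_atTop.comp tendsto_natCast_atTop_atTop)
  apply squeeze_zero (fun N => by positivity) _ h
  intro N
  rcases Nat.eq_zero_or_pos N with rfl | hN
  · simp
  have h1 := Real.nat_sqrt_le_real_sqrt (a := N)
  have h2 : (0:ℝ) < N := by exact_mod_cast hN
  rw [div_le_div_iff₀ h2 (Real.sqrt_pos.2 h2)]
  nlinarith [Real.mul_self_sqrt h2.le, Real.sqrt_pos.2 h2]

lemma good_word {a b G : ℝ} {g : ℕ → ℝ} (ha : a ∈ Icc (0:ℝ) 1) (hb : b ∈ Icc (0:ℝ) 1)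
    (hg : ∀ j, g j ∈ Icc a b) (hG : Tendsto g atTop (nhds G)) : Good a b (word a b g) G := by
  have haG : a ≤ G := ge_of_tendsto' hG fun j => (hg j).1
  have hGb : G ≤ b := le_of_tendsto' hG fun j => (hg j).2
  have hv : ∀ t, val a b t ∈ Icc (0:ℝ) 1 := by
    intro t; unfold val; split_ifs <;> assumption
  constructor
  · unfold Avg
    rw [Metric.tendsto_atTop]
    intro ε' hε'
    set ε := ε'/2 with hε
    have hε0 : 0 < ε := by positivity
    obtain ⟨J, hJ⟩ := Metric.tendsto_atTop.1 hG ε hε0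
    obtain ⟨C1, hC1⟩ := V_upper (a := a) (g := g) hb.2 (by linarith [ha.1]) hε0 haG (J := J)
      (fun j hj => by have := abs_lt.1 (hJ j hj); linarith [this.2])
    obtain ⟨C2, hC2⟩ := V_lower (b := b) (g := g) ha.1 (by linarith [hb.2]) hε0 hGb (J := J)
      (fun j hj => by have := abs_lt.1 (hJ j hj); linarith [this.1])
    have hlim : Tendsto (fun N : ℕ => (|C1| + |C2|) / (N:ℝ) + 4 * ((Nat.sqrt N : ℝ) / N)) atTop
        (nhds 0) := by
      simpa using (tendsto_const_div_atTop_nhds_zero_nat (|C1| + |C2|)).add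
        (tendsto_sqrt_div.const_mul 4)
    obtain ⟨N0, hN0⟩ := (hlim.eventually (gt_mem_nhds hε0)).exists_forall_of_atTop
    refine ⟨N0 + J*J + 1, ?_⟩
    intro N hN
    have hNpos : (0:ℝ) < N := by
      have : 0 < N := by omega
      exact_mod_cast this
    have hs := hN0 N (by nlinarith)
    obtain ⟨j, hj⟩ : ∃ j, j = Nat.sqrt N := ⟨_, rfl⟩
    rw [← hj] at hs
    have hjJ : J ≤ j := by rw [hj, Nat.le_sqrt]; omega
    have hj1 : j * j ≤ N := by rw [hj]; exact Nat.sqrt_le N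
    have hj2 : N ≤ j * j + j + j := by rw [hj]; exact Nat.sqrt_le_add N
    obtain ⟨i, rfl⟩ := Nat.exists_eq_add_of_le hj1
    have hsum := sum_word_sq a b g j i (by omega)
    rw [hsum, Real.dist_eq]
    have hi : (i:ℝ) ≤ 2 * j := by
      have : i ≤ 2 * j := by omega
      exact_mod_cast this
    have hv1 := hv (ty a b g j)
    have u1 := hC1 j hjJ
    have u2 := hC2 j hjJ
    have c1 := le_abs_self C1
    have c2 := le_abs_self C2
    have c3 := abs_nonneg C1
    have c4 := abs_nonneg C2
    have i0 : (0:ℝ) ≤ i := by positivity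
    have j0 : (0:ℝ) ≤ j := by positivity
    have hs' : |C1| + |C2| + 4 * j < ε * ((j*j+i : ℕ):ℝ) := by
      rw [← mul_div_assoc, ← add_div, div_lt_iff₀ hNpos] at hs
      exact hs
    have m1 : 0 ≤ i * val a b (ty a b g j) := mul_nonneg i0 hv1.1
    have m2 : i * val a b (ty a b g j) ≤ i * 1 := mul_le_mul_of_nonneg_left hv1.2 i0
    have G1 : G ≤ 1 := by linarith [hb.2]
    have G0 : 0 ≤ G := by linarith [ha.1]
    have m3 : 0 ≤ i * G := mul_nonneg i0 G0
    have m4 : i * G ≤ i * 1 := mul_le_mul_of_nonneg_left G1 i0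
    have m5 : 0 ≤ i * ε := by positivity
    rw [abs_lt]
    have e2 : ε' = 2 * ε := by rw [hε]; ring
    push_cast at hs' hNpos ⊢
    constructor
    · rw [lt_sub_iff_add_lt, lt_div_iff₀ hNpos]
      rw [e2]
      nlinarith
    · rw [sub_lt_iff_lt_add, div_lt_iff₀ hNpos, e2]
      nlinarith
  · unfold Avg
    apply squeeze_zero (fun N => div_nonneg (Finset.sum_nonneg fun m _ => chg_nonneg _ m)
      (by positivity)) _ tendsto_sqrt_div
    intro N
    gcongr
    induction N with
    | zero => simp
    | succ N ih =>
      rw [Finset.sum_range_succ]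
      have : chg (word a b g) N ≤ (Nat.sqrt (N+1) : ℝ) - Nat.sqrt N := by
        have hm : Nat.sqrt N ≤ Nat.sqrt (N+1) := Nat.sqrt_le_sqrt (by omega)
        unfold chg
        split_ifs with h
        · have : (Nat.sqrt N:ℝ) ≤ Nat.sqrt (N+1) := by exact_mod_cast hm
          linarith
        · have hne : Nat.sqrt N ≠ Nat.sqrt (N+1) := by
            intro h'; apply h; unfold word; rw [h']
          have : (Nat.sqrt N:ℝ) + 1 ≤ Nat.sqrt (N+1) := by
            have : Nat.sqrt N + 1 ≤ Nat.sqrt (N+1) := by omega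
            exact_mod_cast this
          linarith
      linarith

end Micro

namespace Micro

lemma ult_lim (U : Ultrafilter ℕ) (y : ℕ → ℕ → Bool) :
    ∃ x : ℕ → Bool, ∀ m, ∀ᶠ n in (U : Filter ℕ), y n m = x m := by
  have : ∀ m, ∃ t : Bool, ∀ᶠ n in (U : Filter ℕ), y n m = t := by
    intro m
    by_cases h : ∀ᶠ n in (U : Filter ℕ), y n m = true
    · exact ⟨true, h⟩
    · rw [← Ultrafilter.eventually_not] at h
      exact ⟨false, h.mono fun n hn => by simpa using hn⟩
  choose x hx using this
  exact ⟨x, hx⟩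

lemma ult_dich (U : Ultrafilter ℕ) (k : ℕ → ℕ) :
    (∃ c, ∀ᶠ n in (U : Filter ℕ), k n = c) ∨ ∀ B, ∀ᶠ n in (U : Filter ℕ), B < k n := by
  by_cases h : ∀ B, ∀ᶠ n in (U : Filter ℕ), B < k n
  · exact Or.inr h
  · left
    push Not at h
    obtain ⟨B, hB⟩ := h
    induction B with
    | zero => exact ⟨0, hB.mono fun n hn => by omega⟩
    | succ B ih =>
      by_cases h : ∀ᶠ n in (U : Filter ℕ), k n = B + 1
      · exact ⟨_, h⟩
      · rw [← Ultrafilter.eventually_not] at h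
        have h2 : ∀ᶠ n in (U : Filter ℕ), k n ≤ B := by
          filter_upwards [h, hB] with n h1 h2
          omega
        exact ih h2

def enu (i j : ℕ) : Bool := Nat.testBit (Nat.unpair i).1 j

lemma enu_dense (x : ℕ → Bool) (n : ℕ) : ∃ i ≥ n, ∀ j < n, enu i j = x j := by
  refine ⟨Nat.pair (Nat.ofBits (fun j : Fin n => x j)) n, Nat.right_le_pair _ _, ?_⟩
  intro j hj
  unfold enu
  rw [Nat.unpair_pair, Nat.testBit_ofBits_lt _ _ hj]

noncomputable def tau (a b : ℝ) (g : (ℕ → Bool) → ℕ → ℝ) (k : ℕ) : Bool :=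
  decide (k - 2^(Nat.log 2 k) < Nat.log 2 k) &&
    word a b (g (enu (Nat.log 2 k))) (k - 2^(Nat.log 2 k))

lemma tau_eq (a b : ℝ) (g : (ℕ → Bool) → ℕ → ℝ) {i t : ℕ} (ht : t < 2^i) :
    tau a b g (2^i + t) = (decide (t < i) && word a b (g (enu i)) t) := by
  have h : Nat.log 2 (2^i+t) = i :=
    Nat.log_eq_of_pow_le_of_lt_pow (by omega) (by rw [pow_succ]; omega)
  unfold tau
  rw [h, Nat.add_sub_cancel_left]

lemma bv_nonneg (t : Bool) : 0 ≤ bv t := by unfold bv; split_ifs <;> simp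
lemma bv_le (t : Bool) : bv t ≤ 1 := by unfold bv; split_ifs <;> simp

lemma sum_tau (a b : ℝ) (g : (ℕ → Bool) → ℕ → ℝ) (i t : ℕ) (ht : t ≤ 2^i) :
    ∑ m ∈ Finset.range (2^i+t), bv (tau a b g m) ≤
      ∑ m ∈ Finset.range (2^i), bv (tau a b g m) + (min t i : ℕ) := by
  induction t with
  | zero => simp
  | succ t ih =>
    rw [← add_assoc, Finset.sum_range_succ, tau_eq a b g (by omega)]
    have h := ih (by omega)
    by_cases hti : t < i
    · have := bv_le (decide (t < i) && word a b (g (enu i)) t)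
      rw [min_eq_left (by omega)] at h ⊢
      push_cast
      linarith
    · rw [min_eq_right (by omega)] at h ⊢
      simp only [hti, decide_false, Bool.false_and]
      have h0 : bv false = 0 := by simp [bv]
      rw [h0, add_zero]; exact h

lemma sum_tau_pow (a b : ℝ) (g : (ℕ → Bool) → ℕ → ℝ) (i : ℕ) :
    ∑ m ∈ Finset.range (2^i), bv (tau a b g m) ≤ (i:ℝ)^2 := by
  induction i with
  | zero => simp [tau, bv]
  | succ i ih =>
    have h := sum_tau a b g i (2^i) le_rfl
    have h2 : ((min (2^i) i : ℕ):ℝ) ≤ i := by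
      exact_mod_cast min_le_right _ _
    rw [show 2^(i+1) = 2^i + 2^i by ring]
    push_cast
    nlinarith [(Nat.cast_nonneg i : (0:ℝ) ≤ i)]

lemma avg_tau (a b : ℝ) (g : (ℕ → Bool) → ℕ → ℝ) : Avg (fun m => bv (tau a b g m)) 0 := by
  unfold Avg
  have h1 : Tendsto (fun i : ℕ => ((i:ℝ)+1)^2 / 2^i) atTop (nhds 0) := by
    have := ((tendsto_pow_const_div_const_pow_of_one_lt 2 (r := (2:ℝ)) (by norm_num)).comp
      (tendsto_add_atTop_nat 1)).const_mul 2
    simp only [mul_zero] at this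
    refine this.congr ?_
    intro i
    simp only [Function.comp]
    push_cast
    rw [pow_succ (2:ℝ) i]
    field_simp
  have h2 : Tendsto (fun N => Nat.log 2 N) atTop atTop :=
    Filter.tendsto_atTop_atTop.2 fun B => ⟨2^B, fun N hN => Nat.le_log_of_pow_le (by norm_num) hN⟩
  refine squeeze_zero' (Eventually.of_forall fun N => div_nonneg (Finset.sum_nonneg fun m _ =>
    bv_nonneg _) (by positivity)) ?_ (h1.comp h2)
  filter_upwards [eventually_gt_atTop 0] with N hN
  have h3 : N < 2^(Nat.log 2 N + 1) := Nat.lt_pow_succ_log_self (by norm_num) N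
  have h4 : 2^(Nat.log 2 N) ≤ N := Nat.pow_log_le_self 2 (by omega)
  have h5 : ∑ m ∈ Finset.range N, bv (tau a b g m) ≤ ((Nat.log 2 N + 1 : ℕ):ℝ)^2 := by
    refine le_trans ?_ (sum_tau_pow a b g (Nat.log 2 N + 1))
    apply Finset.sum_le_sum_of_subset_of_nonneg
    · intro m hm; simp at *; omega
    · intro m _ _; exact bv_nonneg _
  have h6 : (2:ℝ)^(Nat.log 2 N) ≤ N := by exact_mod_cast h4
  simp only [Function.comp]
  push_cast at h5
  gcongr

lemma Avg.add {f g : ℕ → ℝ} {l k : ℝ} (hf : Avg f l) (hg : Avg g k) :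
    Avg (fun m => f m + g m) (l + k) := by
  unfold Avg at *
  refine (hf.add hg).congr ?_
  intro N
  rw [Finset.sum_add_distrib, add_div]

lemma good_tau {a b : ℝ} (ha : a ∈ Icc (0:ℝ) 1) (hb : b ∈ Icc (0:ℝ) 1)
    (g : (ℕ → Bool) → ℕ → ℝ) : Good a b (tau a b g) a := by
  have h := avg_tau a b g
  have h' := (avg_shift (f := fun m => bv (tau a b g m)) (fun n => by
    rw [abs_of_nonneg (bv_nonneg _)]; exact bv_le _) 1).2 h
  constructor
  · refine (Avg.const a).perturb h (C := 0) ?_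
    intro N
    rw [← Finset.sum_sub_distrib, zero_add]
    refine (Finset.abs_sum_le_sum_abs _ _).trans (Finset.sum_le_sum fun m _ => ?_)
    unfold val bv
    split_ifs
    · rw [abs_le]; constructor <;> linarith [ha.1, ha.2, hb.1, hb.2]
    · simp
  · have h2 := h.add h'
    simp only [add_zero] at h2
    refine (Avg.const 0).perturb h2 (C := 0) ?_
    intro N
    rw [← Finset.sum_sub_distrib, zero_add]
    refine (Finset.abs_sum_le_sum_abs _ _).trans (Finset.sum_le_sum fun m _ => ?_)
    unfold chg bv
    cases tau a b g m <;> cases tau a b g (m+1) <;> simp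

section
variable {a b : ℝ} (ha : a ∈ Icc (0:ℝ) 1) (hb : b ∈ Icc (0:ℝ) 1)
    {g : (ℕ → Bool) → ℕ → ℝ} (hloc : ∀ x y n, (∀ i < n, x i = y i) → g x n = g y n)

lemma tau_word_lim (hloc : ∀ x y n, (∀ i < n, x i = y i) → g x n = g y n)
    {U : Filter ℕ} [U.NeBot] {i : ℕ → ℕ} (hi : ∀ B, ∀ᶠ n in U, B < i n)
    {x : ℕ → Bool} (hx : ∀ m, ∀ᶠ n in U, enu (i n) m = x m) (t : ℕ) :
    ∀ᶠ n in U, tau a b g (2^(i n) + t) = word a b (g x) t := by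
  have h1 : ∀ᶠ n in U, ∀ m ∈ Finset.range (t+1), enu (i n) m = x m :=
    (Filter.eventually_all_finset _).2 fun m _ => hx m
  filter_upwards [h1, hi t] with n h1 h2
  have h3 : i n < 2^(i n) := Nat.lt_two_pow_self
  rw [tau_eq a b g (by omega)]
  simp only [h2, decide_true, Bool.true_and]
  apply word_congr
  intro j hj
  apply hloc
  intro m hm
  exact h1 m (by simp; omega)

lemma ev_eq {U : Filter ℕ} [U.NeBot] {y : ℕ → Bool} {s t : Bool} (h1 : ∀ᶠ n in U, y n = s)
    (h2 : ∀ᶠ n in U, y n = t) : s = t := by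
  obtain ⟨n, h⟩ := (h1.and h2).exists
  rw [← h.1, h.2]

theorem classify (ha : a ∈ Icc (0:ℝ) 1) (hb : b ∈ Icc (0:ℝ) 1)
    (hloc : ∀ x y n, (∀ i < n, x i = y i) → g x n = g y n) (hg : ∀ x j, g x j ∈ Icc a b)
    {G : (ℕ → Bool) → ℝ} (hG : ∀ x, Tendsto (g x) atTop (nhds (G x)))
    {S : Set ℝ} (haS : a ∈ S) (hbS : b ∈ S) (hGS : ∀ x, G x ∈ S)
    (U : Ultrafilter ℕ) (k : ℕ → ℕ) (θ : ℕ → Bool)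
    (hθ : ∀ m, ∀ᶠ n in (U : Filter ℕ), tau a b g (k n + m) = θ m) : ∃ α ∈ S, Good a b θ α := by
  have hval : ∀ t, val a b t ∈ S := by
    intro t; unfold val; split_ifs <;> assumption
  have hconst : ∀ c, ∀ t, (∀ m ≥ c, θ m = t) → ∃ α ∈ S, Good a b θ α := by
    intro c t h
    refine ⟨_, hval t, (good_shift ha hb c).1 ?_⟩
    have : (fun m => θ (m + c)) = fun _ => t := by
      funext m; exact h _ (by omega)
    rw [this]; exact good_const t
  rcases ult_dich U k with ⟨c, hc⟩ | hk
  · refine ⟨a, haS, ?_⟩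
    have : θ = fun m => tau a b g (m + c) := by
      funext m
      refine ev_eq (hθ m) ?_
      filter_upwards [hc] with n hn
      rw [hn, add_comm]
    rw [this, good_shift ha hb c]
    exact good_tau ha hb g
  obtain ⟨i, hi⟩ : ∃ i : ℕ → ℕ, ∀ n, i n = Nat.log 2 (k n) := ⟨_, fun _ => rfl⟩
  have hiB : ∀ B, ∀ᶠ n in (U : Filter ℕ), B < i n := by
    intro B
    filter_upwards [hk (2^(B+1))] with n hn
    rw [hi]
    exact Nat.le_log_of_pow_le (by norm_num) hn.le
  obtain ⟨t, ht⟩ : ∃ t : ℕ → ℕ, ∀ n, t n = k n - 2^(i n) := ⟨_, fun _ => rfl⟩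
  have hkt : ∀ᶠ n in (U : Filter ℕ), k n = 2^(i n) + t n ∧ t n < 2^(i n) := by
    filter_upwards [hk 0] with n hn
    have h1 : 2^(i n) ≤ k n := by rw [hi]; exact Nat.pow_log_le_self 2 (by omega)
    have h2 : k n < 2^(i n + 1) := by rw [hi]; exact Nat.lt_pow_succ_log_self (by norm_num) _
    rw [pow_succ] at h2
    have := ht n
    constructor <;> omega
  rcases ult_dich U t with ⟨c, hc⟩ | htB
  · obtain ⟨x, hx⟩ := ult_lim U (fun n => enu (i n))
    refine ⟨G x, hGS x, ?_⟩
    have : θ = fun m => word a b (g x) (m + c) := by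
      funext m
      refine ev_eq (hθ m) ?_
      filter_upwards [hc, hkt, tau_word_lim hloc hiB hx (m + c)] with n h1 h2 h3
      rw [← h3, h2.1, h1]; congr 1; ring
    rw [this, good_shift ha hb c]
    exact good_word ha hb (hg x) (hG x)
  rcases ult_dich U (fun n => 2^(i n) - t n) with ⟨c, hc⟩ | hr
  · obtain ⟨x, hx⟩ := ult_lim U (fun n => enu (i n + 1))
    refine ⟨G x, hGS x, (good_shift ha hb c).1 ?_⟩
    have : (fun m => θ (m + c)) = word a b (g x) := by
      funext m
      refine ev_eq (hθ (m + c)) ?_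
      filter_upwards [hc, hkt, tau_word_lim hloc (i := fun n => i n + 1)
        (fun B => (hiB B).mono fun n hn => by omega) hx m] with n h1 h2 h3
      rw [← h3]; congr 1; rw [pow_succ]; omega
    rw [this]
    exact good_word ha hb (hg x) (hG x)
  have hwin : ∀ m, ∀ᶠ n in (U : Filter ℕ), tau a b g (k n + m) =
      (decide (t n + m < i n) && word a b (g (enu (i n))) (t n + m)) := by
    intro m
    filter_upwards [hkt, hr m] with n h1 h2
    rw [h1.1, add_assoc, tau_eq a b g (by omega)]
  rcases ult_dich U (fun n => i n - t n) with ⟨c, hc⟩ | hs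
  · apply hconst c false
    intro m hm
    refine ev_eq (hθ m) ?_
    filter_upwards [hc, hwin m] with n h1 h2
    rw [h2]
    have : ¬ (t n + m < i n) := by omega
    simp [this]
  have hwin2 : ∀ m, ∀ᶠ n in (U : Filter ℕ), tau a b g (k n + m) =
      ty a b (g (enu (i n))) (Nat.sqrt (t n + m)) := by
    intro m
    filter_upwards [hwin m, hs m] with n h1 h2
    rw [h1]
    have : (t n + m < i n) := by omega
    simp [this, word]
  have hsq : ∀ B, ∀ᶠ n in (U : Filter ℕ), B < Nat.sqrt (t n) := by
    intro B
    filter_upwards [htB ((B+1)*(B+1))] with n hn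
    exact Nat.le_sqrt.2 hn.le
  rcases ult_dich U (fun n => (Nat.sqrt (t n) + 1)*(Nat.sqrt (t n) + 1) - t n) with ⟨c, hc⟩ | hq
  · apply hconst c (θ c)
    have key : ∀ m ≥ c, ∀ᶠ n in (U : Filter ℕ), tau a b g (k n + m) =
        ty a b (g (enu (i n))) (Nat.sqrt (t n) + 1) := by
      intro m hm
      filter_upwards [hwin2 m, hc, hsq m] with n h1 h2 h3
      rw [h1]
      congr 1
      have h4 : t n < (Nat.sqrt (t n) + 1)*(Nat.sqrt (t n) + 1) := Nat.lt_succ_sqrt (t n)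
      obtain ⟨q, hq⟩ := Nat.exists_eq_add_of_le hm
      have h5 : t n + m = (Nat.sqrt (t n) + 1)*(Nat.sqrt (t n) + 1) + q := by omega
      rw [h5]
      apply Nat.sqrt_add_eq; omega
    intro m hm
    have h1 : ∀ᶠ n in (U : Filter ℕ), tau a b g (k n + m) = θ c := by
      filter_upwards [key m hm, key c le_rfl, hθ c] with n h1 h2 h3
      rw [h1, ← h2, h3]
    exact ev_eq (hθ m) h1
  · apply hconst 0 (θ 0)
    have key : ∀ m, ∀ᶠ n in (U : Filter ℕ), tau a b g (k n + m) =
        ty a b (g (enu (i n))) (Nat.sqrt (t n)) := by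
      intro m
      filter_upwards [hwin2 m, hq m] with n h1 h2
      rw [h1]
      congr 1
      have h4 := Nat.sqrt_le (t n)
      obtain ⟨q, hq⟩ := Nat.exists_eq_add_of_le h4
      have h6 : Nat.sqrt (t n) * Nat.sqrt (t n) + 2 * Nat.sqrt (t n) + 1
        = (Nat.sqrt (t n) + 1)*(Nat.sqrt (t n) + 1) := by ring
      have h5 : t n + m = (Nat.sqrt (t n))*(Nat.sqrt (t n)) + (q + m) := by omega
      conv_lhs => rw [h5]
      apply Nat.sqrt_add_eq; omega
    intro m _
    have h1 : ∀ᶠ n in (U : Filter ℕ), tau a b g (k n + m) = θ 0 := by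
      filter_upwards [key m, key 0, hθ 0] with n h1 h2 h3
      rw [h1, ← h2, h3]
    exact ev_eq (hθ m) h1

end

/-- analytic coding -/
lemma coding {A : Set ℝ} (hne : A.Nonempty) (han : AnalyticSet A) :
    ∃ (g : (ℕ → Bool) → ℕ → ℝ) (G : (ℕ → Bool) → ℝ),
      (∀ x y n, (∀ i < n, x i = y i) → g x n = g y n) ∧ (∀ x n, g x n ∈ A) ∧
      (∀ x, Tendsto (g x) atTop (nhds (G x))) ∧ range G = A := by
  classical
  rw [analyticSet_iff_exists_polishSpace_range] at han
  have han' : AnalyticSet A := analyticSet_iff_exists_polishSpace_range.2 han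
  rcases (by rw [AnalyticSet] at han'; exact han' : A = ∅ ∨ ∃ f : (ℕ → ℕ) → ℝ, Continuous f ∧ range f = A) with h | ⟨f, hf, hr⟩
  · exact absurd h hne.ne_empty
  let D : (ℕ → Bool) → ℕ → ℕ → ℕ := fun x n i =>
    if h : ∃ j, Nat.pair i j < n ∧ x (Nat.pair i j) = true then Nat.find h else 0
  let L : (ℕ → Bool) → ℕ → ℕ := fun x i =>
    if h : ∃ j, x (Nat.pair i j) = true then Nat.find h else 0
  have hD : ∀ x i, ∀ᶠ n in atTop, D x n i = L x i := by
    intro x i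
    by_cases h : ∃ j, x (Nat.pair i j) = true
    · filter_upwards [eventually_gt_atTop (Nat.pair i (Nat.find h))] with n hn
      have h' : ∃ j, Nat.pair i j < n ∧ x (Nat.pair i j) = true := ⟨_, hn, Nat.find_spec h⟩
      simp only [D, L, dif_pos h, dif_pos h']
      apply le_antisymm
      · exact Nat.find_min' _ ⟨hn, Nat.find_spec h⟩
      · exact Nat.find_min' _ (Nat.find_spec h').2
    · refine Eventually.of_forall fun n => ?_
      have h' : ¬ ∃ j, Nat.pair i j < n ∧ x (Nat.pair i j) = true :=
        fun ⟨j, hj⟩ => h ⟨j, hj.2⟩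
      simp only [D, L, dif_neg h, dif_neg h']
  refine ⟨fun x n => f (D x n), fun x => f (L x), ?_, ?_, ?_, ?_⟩
  · intro x y n h
    have : D x n = D y n := by
      funext i
      have : ∀ j, (Nat.pair i j < n ∧ x (Nat.pair i j) = true) ↔
          (Nat.pair i j < n ∧ y (Nat.pair i j) = true) := by
        intro j
        constructor
        · rintro ⟨h1, h2⟩; exact ⟨h1, by rw [← h _ h1]; exact h2⟩
        · rintro ⟨h1, h2⟩; exact ⟨h1, by rw [h _ h1]; exact h2⟩
      simp only [D, this]
    simp only [this]
  · intro x n; rw [← hr]; exact mem_range_self _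
  · intro x
    refine (hf.tendsto (L x)).comp ?_
    rw [tendsto_pi_nhds]
    intro i
    exact tendsto_const_nhds.congr' ((hD x i).mono fun n hn => hn.symm)
  · apply Subset.antisymm
    · rintro _ ⟨x, rfl⟩; rw [← hr]; exact mem_range_self _
    · rw [← hr]
      rintro _ ⟨α, rfl⟩
      refine ⟨fun p => decide (α (Nat.unpair p).1 = (Nat.unpair p).2), ?_⟩
      have : L (fun p => decide (α (Nat.unpair p).1 = (Nat.unpair p).2)) = α := by
        funext i
        have h : ∃ j, (fun p => decide (α (Nat.unpair p).1 = (Nat.unpair p).2)) (Nat.pair i j)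
          = true := ⟨α i, by simp⟩
        simp only [L, dif_pos h]
        have := Nat.find_spec h
        simp only [Nat.unpair_pair, decide_eq_true_eq] at this
        convert this.symm
        simp
      simp only [this]

/-- The combinatorial core. -/
theorem comb {A : Set ℝ} (hne : A.Nonempty) (han : AnalyticSet A) (hA : A ⊆ Icc 0 1)
    (hinf : sInf A ∈ A) (hsup : sSup A ∈ A) :
    ∃ ω : ℕ → Bool,
      (∀ (U : Ultrafilter ℕ) (k : ℕ → ℕ) (η : ℕ → Bool),
        (∀ m, ∀ᶠ n in (U : Filter ℕ), ω (k n + m) = η m) → ∃ α ∈ A, Avg (fun m => bv (η m)) α) ∧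
      (∀ α ∈ A, ∃ k : ℕ → ℕ, ∀ (U : Ultrafilter ℕ), (U : Filter ℕ) ≤ atTop → ∀ η : ℕ → Bool,
        (∀ m, ∀ᶠ n in (U : Filter ℕ), ω (k n + m) = η m) → Avg (fun m => bv (η m)) α) := by
  obtain ⟨g, G, hloc, hgA, hG, hr⟩ := coding hne han
  set a := sInf A with ha'
  set b := sSup A with hb'
  have ha := hA hinf
  have hb := hA hsup
  have hbb : BddBelow A := ⟨0, fun x hx => (hA hx).1⟩
  have hba : BddAbove A := ⟨1, fun x hx => (hA hx).2⟩
  have hg : ∀ x j, g x j ∈ Icc a b := fun x j =>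
    ⟨csInf_le hbb (hgA x j), le_csSup hba (hgA x j)⟩
  refine ⟨digs a b (tau a b g), ?_, ?_⟩
  · intro U k η hη
    obtain ⟨θ, hθ⟩ := ult_lim U (fun n m => tau a b g (k n + m))
    obtain ⟨α, hα, hgood⟩ := classify ha hb hloc hg hG hinf hsup
      (fun x => hr ▸ mem_range_self x) U k θ hθ
    exact ⟨α, hα, freq_of_good ha hb hη hθ hgood⟩
  · intro α hα
    rw [← hr] at hα
    obtain ⟨x, rfl⟩ := hα
    choose i hi1 hi2 using enu_dense x
    refine ⟨fun n => 2^(i n), ?_⟩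
    intro U hU η hη
    have hiB : ∀ B, ∀ᶠ n in (U : Filter ℕ), B < i n := fun B =>
      hU ((eventually_gt_atTop B).mono fun n hn => lt_of_lt_of_le hn (hi1 n))
    have hx : ∀ m, ∀ᶠ n in (U : Filter ℕ), enu (i n) m = x m := fun m =>
      hU ((eventually_gt_atTop m).mono fun n hn => hi2 n m hn)
    exact freq_of_good ha hb hη (fun m => tau_word_lim hloc hiB hx m)
      (good_word ha hb (hg x) (hG x))

end Micro

namespace Micro

noncomputable def pt (x : ℕ → Bool) : ℝ := ∑' k, bv (x k) * (1/2:ℝ)^(k+1)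

lemma geo_sum : Summable (fun k : ℕ => (1/2:ℝ)^(k+1)) :=
  (summable_nat_add_iff 1).2 summable_geometric_two

lemma pt_le_geo (x : ℕ → Bool) (k : ℕ) : bv (x k) * (1/2:ℝ)^(k+1) ≤ (1/2:ℝ)^(k+1) :=
  mul_le_of_le_one_left (by positivity) (bv_le _)

lemma pt_term_nonneg (x : ℕ → Bool) (k : ℕ) : 0 ≤ bv (x k) * (1/2:ℝ)^(k+1) :=
  mul_nonneg (bv_nonneg _) (by positivity)

lemma pt_summable (x : ℕ → Bool) : Summable (fun k => bv (x k) * (1/2:ℝ)^(k+1)) :=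
  Summable.of_nonneg_of_le (pt_term_nonneg x) (pt_le_geo x) geo_sum

lemma pt_nonneg (x : ℕ → Bool) : 0 ≤ pt x := tsum_nonneg (pt_term_nonneg x)

lemma pt_le_one (x : ℕ → Bool) : pt x ≤ 1 := by
  have h := (pt_summable x).tsum_le_tsum (pt_le_geo x) geo_sum
  have h2 : ∑' k : ℕ, (1/2:ℝ)^(k+1) = 1 := by
    have := summable_geometric_two.tsum_eq_zero_add
    rw [tsum_geometric_two] at this
    simp only [pow_zero] at this
    linarith
  rw [h2] at h
  exact h

lemma pt_cont : Continuous pt := by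
  unfold pt
  refine continuous_tsum (fun k => ?_) geo_sum ?_
  · have : Continuous (fun x : ℕ → Bool => bv (x k)) :=
      (continuous_of_discreteTopology (f := bv)).comp (continuous_apply k)
    fun_prop
  · intro k x
    rw [Real.norm_of_nonneg (pt_term_nonneg x k)]
    exact pt_le_geo x k

def hd (x : ℕ → Bool) : ℕ → ℕ
  | 0 => 0
  | n+1 => 2 * hd x n + (x n).toNat

lemma bv_toNat (t : Bool) : bv t = (t.toNat : ℝ) := by cases t <;> simp [bv]

lemma pt_succ (x : ℕ → Bool) : pt x = (bv (x 0) + pt (fun k => x (1 + k))) / 2 := by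
  unfold pt
  rw [(pt_summable x).tsum_eq_zero_add]
  have : ∀ k, bv (x (k+1)) * (1/2:ℝ)^(k+1+1) = (1/2) * (bv (x (1 + k)) * (1/2:ℝ)^(k+1)) := by
    intro k; rw [add_comm 1 k]; ring
  simp only [this, tsum_mul_left]
  ring

lemma pt_head (x : ℕ → Bool) (n : ℕ) : pt x = (hd x n + pt (fun k => x (n + k))) / 2^n := by
  induction n with
  | zero => simp [hd]
  | succ n ih =>
    rw [ih, pt_succ (fun k => x (n + k)), hd]
    have : (fun k => x (n + (1 + k))) = fun k => x (n + 1 + k) := by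
      funext k; rw [add_assoc]
    rw [this, add_zero, bv_toNat]
    push_cast
    rw [pow_succ]
    field_simp
    ring

lemma hd_congr {x y : ℕ → Bool} {n : ℕ} (h : ∀ k < n, x k = y k) : hd x n = hd y n := by
  induction n with
  | zero => rfl
  | succ n ih => rw [hd, hd, ih fun k hk => h k (by omega), h n (by omega)]

def Sub (x ω : ℕ → Bool) : Prop := ∀ k, x k = true → ω k = true

def C (ω : ℕ → Bool) : Set ℝ := pt '' {x | Sub x ω}

def KK (d : ℕ) (ω : ℕ → Bool) : Set (Fin d → ℝ) := Set.univ.pi fun _ => C ω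

lemma C_compact (ω : ℕ → Bool) : IsCompact (C ω) := by
  refine IsCompact.image (IsClosed.isCompact ?_) pt_cont
  have : {x : ℕ → Bool | Sub x ω} = ⋂ k, (fun x : ℕ → Bool => x k) ⁻¹' {t | t = true → ω k = true} := by
    ext x; simp [Sub]
  rw [this]
  exact isClosed_iInter fun k => (isClosed_discrete _).preimage (continuous_apply k)

lemma KK_compact (d : ℕ) (ω : ℕ → Bool) : IsCompact (KK d ω) :=
  isCompact_univ_pi fun _ => C_compact ω

def sh (p : ℕ) (ω : ℕ → Bool) : ℕ → Bool := fun k => ω (p + k)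

lemma mem_KK {d : ℕ} {ω : ℕ → Bool} {z : Fin d → ℝ} (hz : z ∈ KK d ω) :
    ∃ X : Fin d → ℕ → Bool, (∀ i, Sub (X i) ω) ∧ ∀ i, z i = pt (X i) := by
  have : ∀ i, ∃ x, Sub x ω ∧ pt x = z i := fun i => hz i (mem_univ i)
  choose X h1 h2 using this
  exact ⟨X, h1, fun i => (h2 i).symm⟩

lemma KK_mem {d : ℕ} {ω : ℕ → Bool} {X : Fin d → ℕ → Bool} (h : ∀ i, Sub (X i) ω) :
    (fun i => pt (X i)) ∈ KK d ω := fun i _ => ⟨X i, h i, rfl⟩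

def sm (ω : ℕ → Bool) (n : ℕ) : ℕ := ∑ m ∈ Finset.range n, (ω m).toNat

lemma sm_cast (ω : ℕ → Bool) (n : ℕ) : (sm ω n : ℝ) = ∑ m ∈ Finset.range n, bv (ω m) := by
  unfold sm; push_cast; exact Finset.sum_congr rfl fun m _ => (bv_toNat _).symm

lemma sm_succ (ω : ℕ → Bool) (n : ℕ) : sm ω (n+1) = sm ω n + (ω n).toNat := Finset.sum_range_succ _ _

lemma sm_congr {x y : ℕ → Bool} {n : ℕ} (h : ∀ k < n, x k = y k) : sm x n = sm y n :=
  Finset.sum_congr rfl fun m hm => by rw [h m (Finset.mem_range.1 hm)]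

def WW (ω : ℕ → Bool) : ℕ → Finset ℕ
  | 0 => {0}
  | n+1 => (WW ω n).image (fun a => 2 * a) ∪
      (if ω n then (WW ω n).image (fun a => 2 * a + 1) else ∅)

lemma WW_card (ω : ℕ → Bool) (n : ℕ) : (WW ω n).card ≤ 2 ^ sm ω n := by
  induction n with
  | zero => simp [WW, sm]
  | succ n ih =>
    rw [WW, sm_succ]
    refine (Finset.card_union_le _ _).trans ?_
    have h1 : ((WW ω n).image (fun a => 2 * a)).card ≤ 2 ^ sm ω n := Finset.card_image_le.trans ih
    have h2 : ((WW ω n).image (fun a => 2 * a + 1)).card ≤ 2 ^ sm ω n := Finset.card_image_le.trans ih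
    cases h : ω n
    · simpa using h1
    · simp only [if_true, Bool.toNat_true, pow_succ]; omega

lemma hd_mem {x ω : ℕ → Bool} (h : Sub x ω) (n : ℕ) : hd x n ∈ WW ω n := by
  induction n with
  | zero => simp [WW, hd]
  | succ n ih =>
    rw [WW, hd, Finset.mem_union]
    cases hx : x n
    · left; exact Finset.mem_image.2 ⟨_, ih, by simp⟩
    · right; rw [if_pos (h n hx)]; exact Finset.mem_image.2 ⟨_, ih, by simp⟩

/-- one-dimensional cover -/
lemma cover1 (ω : ℕ → Bool) (k j : ℕ) (l u : ℝ) (h1 : 2^k ≤ l) (h2 : l < 2^(k+1)) :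
    ∃ T : Finset ℝ, T.card ≤ 3 * 2 ^ sm (sh k ω) j ∧
      ∀ x, Sub x ω → l * pt x + u ∈ Icc (0:ℝ) 1 → ∃ c ∈ T, |l * pt x + u - c| ≤ (1/2)^j := by
  have hk : (0:ℝ) < 2^k := by positivity
  set c := l / 2^k with hc
  have hl : l = c * 2^k := by rw [hc]; field_simp
  have hc1 : 1 ≤ c := by rw [hc, le_div_iff₀ hk]; linarith
  have hc2 : c < 2 := by rw [hc, div_lt_iff₀ hk]; rw [pow_succ] at h2; linarith
  let m : ℤ := ⌈-u/c - 1⌉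
  refine ⟨((Finset.Icc m (m+2)) ×ˢ (WW (sh k ω) j)).image
    (fun p => c * ((p.1:ℝ) + p.2 / 2^j) + c / 2^(j+1) + u), ?_, ?_⟩
  · refine Finset.card_image_le.trans ?_
    rw [Finset.card_product]
    refine Nat.mul_le_mul ?_ (WW_card _ _)
    simp only [Int.card_Icc]; omega
  · intro x hx hy
    have e1 := pt_head x k
    have e2 := pt_head (sh k x) j
    have e3 : l * pt x + u = c * (hd x k + pt (sh k x)) + u := by
      rw [e1, hl]; unfold sh; field_simp
    have b1 := pt_nonneg (sh k x)
    have b2 := pt_le_one (sh k x)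
    have b3 := pt_nonneg (fun n => (sh k x) (j + n))
    have b4 := pt_le_one (fun n => (sh k x) (j + n))
    rw [e3] at hy ⊢
    refine ⟨_, Finset.mem_image.2 ⟨((hd x k : ℤ), hd (sh k x) j), ?_, rfl⟩, ?_⟩
    · rw [Finset.mem_product]
      refine ⟨?_, hd_mem (fun n hn => hx _ hn) j⟩
      rw [Finset.mem_Icc]
      constructor
      · rw [Int.ceil_le, sub_le_iff_le_add, div_le_iff₀ (by linarith)]
        push_cast
        nlinarith [hy.1]
      · have h3 : -u/c - 1 ≤ m := Int.le_ceil _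
        rw [sub_le_iff_le_add, div_le_iff₀ (by linarith)] at h3
        have h4 : ((hd x k : ℤ):ℝ) < m + 3 := by
          push_cast
          by_contra hcon
          push Not at hcon
          have h5 := hy.2
          nlinarith
        have : (hd x k : ℤ) < m + 3 := by exact_mod_cast h4
        omega
    · rw [e2]
      have hj : (0:ℝ) < 2^j := by positivity
      have : c * (↑(hd x k) + (↑(hd (sh k x) j) + pt fun n => sh k x (j + n)) / 2 ^ j) + u -
          (c * (((hd x k : ℤ):ℝ) + ↑(hd (sh k x) j) / 2 ^ j) + c / 2 ^ (j + 1) + u)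
          = (c * ((pt fun n => sh k x (j + n)) - 1/2)) * (1/2)^j := by
        push_cast
        rw [one_div, inv_pow, pow_succ]
        field_simp
        ring
      rw [this, abs_mul, abs_of_pos (by positivity : (0:ℝ) < (1/2)^j)]
      refine mul_le_of_le_one_left (by positivity) ?_
      rw [abs_le]
      constructor <;> nlinarith

lemma coverd (d : ℕ) (ω : ℕ → Bool) (k j : ℕ) (l : ℝ) (u : Fin d → ℝ) (h1 : 2^k ≤ l)
    (h2 : l < 2^(k+1)) :
    ∃ T : Finset (Fin d → ℝ), T.card ≤ (3 * 2 ^ sm (sh k ω) j)^d ∧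
      ∀ y ∈ ((fun z => l • z + u) '' (KK d ω)) ∩ Set.univ.pi (fun _ => Set.Icc (0 : ℝ) 1),
        ∃ c ∈ T, dist y c ≤ (1/2)^j := by
  choose T hT1 hT2 using fun i => cover1 ω k j l (u i) h1 h2
  refine ⟨Fintype.piFinset T, ?_, ?_⟩
  · rw [Fintype.card_piFinset]
    refine (Finset.prod_le_prod' fun i _ => hT1 i).trans ?_
    simp
  · rintro y ⟨⟨z, hz, rfl⟩, hy⟩
    obtain ⟨X, hX1, hX2⟩ := mem_KK hz
    have : ∀ i, ∃ c ∈ T i, |l * pt (X i) + u i - c| ≤ (1/2)^j := by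
      intro i
      refine hT2 i (X i) (hX1 i) ?_
      have := hy i (mem_univ i)
      simpa [hX2 i] using this
    choose c hc1 hc2 using this
    refine ⟨c, by simpa using hc1, ?_⟩
    rw [dist_pi_le_iff (by positivity)]
    intro i
    rw [Real.dist_eq]
    simpa [hX2 i] using hc2 i

end Micro

namespace Micro

lemma coverNum_spec {X : Type*} [MetricSpace X] {s : Set X} {n : ℕ}
    (h : ∃ t : Finset X, s ⊆ ⋃ y ∈ t, Metric.closedBall y ((2 : ℝ) ^ (-(n : ℤ)))) :
    ∃ t : Finset X, t.card = coverNum s n ∧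
      s ⊆ ⋃ y ∈ t, Metric.closedBall y ((2 : ℝ) ^ (-(n : ℤ))) := by
  obtain ⟨t, ht⟩ := h
  exact Nat.sInf_mem (s := {m : ℕ | ∃ t : Finset X, t.card = m ∧
    s ⊆ ⋃ y ∈ t, Metric.closedBall y ((2 : ℝ) ^ (-(n : ℤ)))}) ⟨_, t, rfl, ht⟩

lemma coverNum_le {X : Type*} [MetricSpace X] {s : Set X} {n : ℕ} (t : Finset X)
    (ht : s ⊆ ⋃ y ∈ t, Metric.closedBall y ((2 : ℝ) ^ (-(n : ℤ)))) : coverNum s n ≤ t.card :=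
  Nat.sInf_le ⟨t, rfl, ht⟩

lemma zp (n : ℕ) : (2:ℝ)^(-(n:ℤ)) = (1/2)^n := by
  rw [zpow_neg, zpow_natCast, one_div, inv_pow]

lemma dimH_le_ubDim {X : Type*} [MetricSpace X] {s : Set X}
    (h : ∀ n : ℕ, ∃ t : Finset X, s ⊆ ⋃ y ∈ t, Metric.closedBall y ((2 : ℝ) ^ (-(n : ℤ)))) :
    dimH s ≤ ubDim s := by
  by_contra hcon
  push Not at hcon
  obtain ⟨r, hr1, hr2⟩ := ENNReal.lt_iff_exists_nnreal_btwn.1 hcon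
  have hev := Filter.eventually_lt_of_limsup_lt hr1
  choose t ht1 ht2 using fun n => coverNum_spec (h n)
  borelize X
  refine absurd (dimH_le_of_hausdorffMeasure_ne_top (s := s) (d := r) ?_) (not_le.2 hr2)
  have hrad : Tendsto (fun n : ℕ => ENNReal.ofReal (2 * (1/2)^n)) atTop (nhds 0) := by
    rw [← ENNReal.ofReal_zero]
    apply ENNReal.tendsto_ofReal
    have := (tendsto_pow_atTop_nhds_zero_of_lt_one (r := (1/2:ℝ)) (by norm_num)
      (by norm_num)).const_mul 2
    simpa using this
  have hdiam : ∀ (n : ℕ) (y : X), Metric.ediam (Metric.closedBall y ((2 : ℝ) ^ (-(n : ℤ)))) ≤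
      ENNReal.ofReal (2 * (1/2)^n) := by
    intro n y
    rw [zp]
    apply Metric.ediam_le
    intro a ha b hb
    rw [edist_dist]
    apply ENNReal.ofReal_le_ofReal
    have := dist_triangle_right a b y
    rw [Metric.mem_closedBall] at ha hb
    linarith
  have key := Measure.hausdorffMeasure_le_liminf_sum (r:ℝ) s
    (fun n : ℕ => ENNReal.ofReal (2 * (1/2)^n)) hrad
    (ι := fun n => (t n : Type _)) (fun n y => Metric.closedBall (y:X) ((2 : ℝ) ^ (-(n : ℤ))))
    (Eventually.of_forall fun n y => hdiam n y)
    (Eventually.of_forall fun n => by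
      intro x hx
      have := ht2 n hx
      simpa using this)
  refine ne_top_of_le_ne_top (b := ENNReal.ofReal ((2:ℝ)^(r:ℝ))) ENNReal.ofReal_ne_top
    (key.trans ?_)
  refine (Filter.liminf_le_liminf (v := fun _ => ENNReal.ofReal ((2:ℝ)^(r:ℝ))) ?_).trans ?_
  · filter_upwards [hev, eventually_gt_atTop 0] with n hn hn0
    have hn0' : (0:ℝ) < n := by exact_mod_cast hn0
    have hl2 : 0 < Real.log 2 := Real.log_pos (by norm_num)
    have h1 : Real.log (coverNum s n) / (n * Real.log 2) < r := by
      by_contra hc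
      push Not at hc
      have := ENNReal.ofReal_le_ofReal hc
      rw [ENNReal.ofReal_coe_nnreal] at this
      exact absurd hn (not_lt.2 this)
    rw [div_lt_iff₀ (by positivity)] at h1
    have h2 : (coverNum s n : ℝ) ≤ (2:ℝ)^((r:ℝ) * n) := by
      rcases Nat.eq_zero_or_pos (coverNum s n) with h0 | h0
      · rw [h0]; simp only [Nat.cast_zero]; positivity
      · rw [Real.le_rpow_iff_log_le (by exact_mod_cast h0) (by norm_num)]
        linarith
    calc ∑ y : t n, Metric.ediam (Metric.closedBall (y:X) ((2 : ℝ) ^ (-(n : ℤ)))) ^ (r:ℝ)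
        ≤ ∑ y : t n, (ENNReal.ofReal (2 * (1/2)^n))^(r:ℝ) :=
          Finset.sum_le_sum fun y _ => ENNReal.rpow_le_rpow (hdiam n y) r.coe_nonneg
      _ = (coverNum s n : ℝ≥0∞) * (ENNReal.ofReal (2 * (1/2)^n))^(r:ℝ) := by
          rw [Finset.sum_const, nsmul_eq_mul]
          simp [ht1]
      _ = ENNReal.ofReal ((coverNum s n : ℝ) * (2 * (1/2)^n)^(r:ℝ)) := by
          rw [ENNReal.ofReal_mul (Nat.cast_nonneg (coverNum s n)), ENNReal.ofReal_rpow_of_nonneg (by positivity) r.coe_nonneg,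
            ENNReal.ofReal_natCast]
      _ ≤ ENNReal.ofReal ((2:ℝ)^(r:ℝ)) := by
          apply ENNReal.ofReal_le_ofReal
          rw [Real.mul_rpow (by norm_num) (by positivity)]
          have h3 : (((1/2:ℝ)^n)^(r:ℝ)) = ((2:ℝ)^((r:ℝ) * n))⁻¹ := by
            rw [one_div, inv_pow, Real.inv_rpow (by positivity), mul_comm (r:ℝ), Real.rpow_mul (by norm_num),
              Real.rpow_natCast]
          rw [h3]
          have h4 : (0:ℝ) < (2:ℝ)^((r:ℝ) * n) := by positivity
          have h5 : (0:ℝ) < (2:ℝ)^(r:ℝ) := by positivity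
          calc (coverNum s n : ℝ) * ((2:ℝ)^(r:ℝ) * ((2:ℝ)^((r:ℝ) * n))⁻¹)
              ≤ (2:ℝ)^((r:ℝ) * n) * ((2:ℝ)^(r:ℝ) * ((2:ℝ)^((r:ℝ) * n))⁻¹) := by gcongr
            _ = (2:ℝ)^(r:ℝ) := by field_simp
  · simp

lemma ubDim_le {X : Type*} [MetricSpace X] {s : Set X} (d : ℕ) {η : ℕ → Bool} {α : ℝ}
    (hη : Avg (fun m => bv (η m)) α)
    (h : ∀ n : ℕ, coverNum s n ≤ (3 * 2 ^ sm η (n+1))^d) :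
    ubDim s ≤ ENNReal.ofReal (d * α) := by
  have hl2 : 0 < Real.log 2 := Real.log_pos (by norm_num)
  have h1 : Tendsto (fun n : ℕ => ENNReal.ofReal
      (d * (((Real.log 3 / Real.log 2) + 1) * (1 / n) + (∑ m ∈ Finset.range n, bv (η m)) / n))) atTop
      (nhds (ENNReal.ofReal (d * α))) := by
    apply ENNReal.tendsto_ofReal
    have := ((tendsto_one_div_atTop_nhds_zero_nat.const_mul
      ((Real.log 3 / Real.log 2) + 1)).add hη).const_mul (d:ℝ)
    simpa using this
  rw [← h1.limsup_eq]
  refine Filter.limsup_le_limsup ?_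
  · filter_upwards [eventually_gt_atTop 0] with n hn
    have hn' : (0:ℝ) < n := by exact_mod_cast hn
    apply ENNReal.ofReal_le_ofReal
    have h2 : Real.log (coverNum s n) ≤ d * (Real.log 3 + sm η (n+1) * Real.log 2) := by
      rcases Nat.eq_zero_or_pos (coverNum s n) with h0 | h0
      · rw [h0]
        simp only [Nat.cast_zero, Real.log_zero]
        have : 0 < Real.log 3 := Real.log_pos (by norm_num)
        positivity
      · have h3 : (coverNum s n : ℝ) ≤ (3 * 2 ^ sm η (n+1))^d := by exact_mod_cast h n
        refine (Real.log_le_log (by exact_mod_cast h0) h3).trans ?_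
        rw [Real.log_pow, Real.log_mul (by norm_num) (by positivity), Real.log_pow]
    have h4 : (sm η (n+1) : ℝ) ≤ ∑ m ∈ Finset.range n, bv (η m) + 1 := by
      rw [sm_cast, Finset.sum_range_succ]
      linarith [bv_le (η n)]
    rw [div_le_iff₀ (by positivity)]
    refine h2.trans ?_
    have : (d:ℝ) * ((Real.log 3 / Real.log 2 + 1) * (1 / ↑n) + (∑ m ∈ Finset.range n, bv (η m)) / ↑n) *
      (↑n * Real.log 2) = d * (Real.log 3 + (∑ m ∈ Finset.range n, bv (η m) + 1) * Real.log 2) := by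
      field_simp
      ring
    rw [this]
    gcongr

end Micro

namespace Micro

noncomputable def RR (η : ℕ → Bool) (t : ℝ) : ℕ → ℝ
  | 0 => t
  | n+1 => if η n then 2 * RR η t n - (if 1/2 ≤ RR η t n then 1 else 0) else RR η t n

noncomputable def gd (η : ℕ → Bool) (t : ℝ) (n : ℕ) : Bool := η n && decide (1/2 ≤ RR η t n)

def QQ (η x : ℕ → Bool) : ℕ → ℤ
  | 0 => 0
  | n+1 => if η n then 2 * QQ η x n + (x n).toNat else QQ η x n

lemma gd_sub (η : ℕ → Bool) (t : ℝ) : Sub (gd η t) η := by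
  intro k hk
  unfold gd at hk
  simp at hk
  exact hk.1

lemma RR_mem (η : ℕ → Bool) {t : ℝ} (ht : t ∈ Icc (0:ℝ) 1) (n : ℕ) : RR η t n ∈ Icc (0:ℝ) 1 := by
  induction n with
  | zero => exact ht
  | succ n ih =>
    rw [RR]
    split_ifs with h1 h2
    · constructor <;> linarith [ih.1, ih.2]
    · push Not at h2
      constructor <;> linarith [ih.1, ih.2]
    · exact ih

lemma QQ_eq (η : ℕ → Bool) (t : ℝ) (n : ℕ) :
    t * 2^(sm η n) = QQ η (gd η t) n + RR η t n := by
  induction n with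
  | zero => simp [sm, QQ, RR]
  | succ n ih =>
    rw [sm_succ, pow_add, ← mul_assoc, ih, QQ, RR, gd]
    cases h : η n
    · simp
    · by_cases h2 : 1/2 ≤ RR η t n
      · simp only [h2]; simp; ring
      · simp only [h2]; simp; ring

lemma inv_key {η x y : ℕ → Bool} (hx : Sub x η) (hy : Sub y η) (n : ℕ) :
    ((hd x n : ℤ) - hd y n = 0 ∧ QQ η x n - QQ η y n = 0) ∨
    (1 ≤ QQ η x n - QQ η y n ∧ QQ η x n - QQ η y n ≤ (hd x n : ℤ) - hd y n) ∨
    (QQ η x n - QQ η y n ≤ -1 ∧ (hd x n : ℤ) - hd y n ≤ QQ η x n - QQ η y n) := by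
  induction n with
  | zero => left; simp [hd, QQ]
  | succ n ih =>
    rw [hd, hd, QQ, QQ]
    have h1 := hx n
    have h2 := hy n
    cases h : η n
    · have h1 : x n = false := by
        cases h3 : x n
        · rfl
        · rw [h1 h3] at h; cases h
      have h2 : y n = false := by
        cases h3 : y n
        · rfl
        · rw [h2 h3] at h; cases h
      rw [h1, h2]
      simp only [Bool.toNat_false, Nat.cast_add, Nat.cast_mul, Nat.cast_ofNat, Nat.cast_zero]
      simp only [Bool.false_eq_true, if_false]
      omega
    · simp only [if_true]
      have b1 : (x n).toNat ≤ 1 := Bool.toNat_le _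
      have b2 : (y n).toNat ≤ 1 := Bool.toNat_le _
      push_cast
      omega

lemma sep {η : ℕ → Bool} {t s : ℝ} (ht : t ∈ Icc (0:ℝ) 1) (hs : s ∈ Icc (0:ℝ) 1) (n : ℕ)
    (h : |pt (gd η t) - pt (gd η s)| ≤ (1/2)^n) : |t - s| * 2^(sm η n) ≤ 3 := by
  have e1 := pt_head (gd η t) n
  have e2 := pt_head (gd η s) n
  have a1 := pt_nonneg (fun k => gd η t (n+k))
  have a2 := pt_le_one (fun k => gd η t (n+k))
  have a3 := pt_nonneg (fun k => gd η s (n+k))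
  have a4 := pt_le_one (fun k => gd η s (n+k))
  have hn : (0:ℝ) < 2^n := by positivity
  have h1 : |(hd (gd η t) n + pt (fun k => gd η t (n+k))) - (hd (gd η s) n + pt (fun k => gd η s (n+k)))| ≤ 1 := by
    rw [e1, e2, ← sub_div, abs_div, abs_of_pos hn, div_le_iff₀ hn, one_div, inv_pow,
      inv_mul_cancel₀ hn.ne'] at h
    exact h
  rw [abs_le] at h1
  have h2 : ((hd (gd η t) n : ℤ) - (hd (gd η s) n : ℤ)) ≤ 2 := by
    have : ((hd (gd η t) n : ℝ) - (hd (gd η s) n : ℝ)) ≤ 2 := by linarith [h1.2]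
    exact_mod_cast this
  have h3 : -2 ≤ ((hd (gd η t) n : ℤ) - (hd (gd η s) n : ℤ)) := by
    have : -2 ≤ ((hd (gd η t) n : ℝ) - (hd (gd η s) n : ℝ)) := by linarith [h1.1]
    exact_mod_cast this
  have h4 := inv_key (gd_sub η t) (gd_sub η s) n
  have h5 : QQ η (gd η t) n - QQ η (gd η s) n ≤ 2 := by omega
  have h6 : -2 ≤ QQ η (gd η t) n - QQ η (gd η s) n := by omega
  have h5' : (QQ η (gd η t) n : ℝ) - QQ η (gd η s) n ≤ 2 := by exact_mod_cast h5
  have h6' : -2 ≤ (QQ η (gd η t) n : ℝ) - QQ η (gd η s) n := by exact_mod_cast h6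
  have q1 := QQ_eq η t n
  have q2 := QQ_eq η s n
  have r1 := RR_mem η ht n
  have r2 := RR_mem η hs n
  rw [← abs_of_pos (by positivity : (0:ℝ) < 2^(sm η n)), ← abs_mul, sub_mul, q1, q2, abs_le]
  constructor <;> linarith [r1.1, r1.2, r2.1, r2.2]

lemma sm_lower {η : ℕ → Bool} {α r : ℝ} (hη : Avg (fun m => bv (η m)) α) (hr0 : 0 < r) (hr : r < α) :
    ∃ M : ℝ, ∀ n : ℕ, r * n - M ≤ sm η n := by
  have h := hη.eventually (lt_mem_nhds hr)
  obtain ⟨N, hN⟩ := eventually_atTop.1 h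
  refine ⟨r * N, fun n => ?_⟩
  rcases le_or_gt N n with h1 | h1
  · rcases Nat.eq_zero_or_pos n with h0 | h0
    · subst h0
      have : (0:ℝ) ≤ r * N := by positivity
      simp [sm]; linarith
    · have h2 := hN n h1
      have h0' : (0:ℝ) < n := by exact_mod_cast h0
      rw [lt_div_iff₀ h0', ← sm_cast] at h2
      have : (0:ℝ) ≤ r * N := by positivity
      linarith
  · have : (n:ℝ) ≤ N := by exact_mod_cast h1.le
    have h3 : (0:ℝ) ≤ sm η n := by positivity
    nlinarith

lemma holder1 {η : ℕ → Bool} {α r : ℝ} (hη : Avg (fun m => bv (η m)) α) (hr0 : 0 < r) (hr : r < α) :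
    ∃ B : ℝ, 0 ≤ B ∧ ∀ t ∈ Icc (0:ℝ) 1, ∀ s ∈ Icc (0:ℝ) 1,
      |t - s| ≤ B * |pt (gd η t) - pt (gd η s)| ^ r := by
  obtain ⟨M, hM⟩ := sm_lower hη hr0 hr
  refine ⟨3 * 2^M * 2^r, by positivity, ?_⟩
  intro t ht s hs
  have key : ∀ n : ℕ, |pt (gd η t) - pt (gd η s)| ≤ (1/2)^n → |t - s| ≤ 3 * 2^M * ((1/2:ℝ)^n)^r := by
    intro n hn
    have h1 := sep ht hs n hn
    have h2 : (2:ℝ)^(r * n - M) ≤ 2^(sm η n) := by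
      rw [← Real.rpow_natCast]
      exact Real.rpow_le_rpow_of_exponent_le (by norm_num) (hM n)
    have h3 : (2:ℝ)^(r * n - M) = (2^M * ((1/2:ℝ)^n)^r)⁻¹ := by
      rw [Real.rpow_sub (by norm_num), mul_inv, one_div, inv_pow, Real.inv_rpow (by positivity), inv_inv,
        mul_comm r, Real.rpow_mul (by norm_num), Real.rpow_natCast]
      field_simp
    have h4 : |t - s| * (2^M * ((1/2:ℝ)^n)^r)⁻¹ ≤ 3 := by
      rw [← h3]
      exact (mul_le_mul_of_nonneg_left h2 (abs_nonneg _)).trans h1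
    rw [← div_eq_mul_inv, div_le_iff₀ (by positivity)] at h4
    linarith
  rcases eq_or_lt_of_le (abs_nonneg (pt (gd η t) - pt (gd η s))) with h0 | h0
  · rw [← h0, Real.zero_rpow hr0.ne', mul_zero]
    have hlim : Tendsto (fun n : ℕ => 3 * 2^M * ((1/2:ℝ)^n)^r) atTop (nhds 0) := by
      have h1 := (tendsto_pow_atTop_nhds_zero_of_lt_one (r := (1/2:ℝ)) (by norm_num)
        (by norm_num)).rpow_const (p := r) (Or.inr hr0.le)
      have := h1.const_mul (3 * 2^M : ℝ)
      rw [Real.zero_rpow hr0.ne', mul_zero] at this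
      exact this
    exact ge_of_tendsto' hlim fun n => key n (by rw [← h0]; positivity)
  · have hle : |pt (gd η t) - pt (gd η s)| ≤ 1 := by
      rw [abs_le]
      constructor <;> linarith [pt_nonneg (gd η t), pt_le_one (gd η t), pt_nonneg (gd η s), pt_le_one (gd η s)]
    obtain ⟨n, hn1, hn2⟩ := exists_nat_pow_near_of_lt_one h0 hle (y := (1/2:ℝ)) (by norm_num) (by norm_num)
    refine (key n hn2).trans ?_
    rw [mul_assoc (3 * 2^M : ℝ), ← Real.mul_rpow (by norm_num) (abs_nonneg _)]
    have : (1/2:ℝ)^n ≤ 2 * |pt (gd η t) - pt (gd η s)| := by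
      rw [pow_succ] at hn1
      linarith
    gcongr

lemma dimH_KK {d : ℕ} {η : ℕ → Bool} {α : ℝ} (hη : Avg (fun m => bv (η m)) α) :
    ENNReal.ofReal (d * α) ≤ dimH (KK d η) := by
  rcases le_or_gt α 0 with h0 | h0
  · rw [ENNReal.ofReal_of_nonpos (mul_nonpos_of_nonneg_of_nonpos (by positivity) h0)]
    exact bot_le
  have main : ∀ r, 0 < r → r < α → ENNReal.ofReal (d * r) ≤ dimH (KK d η) := by
    intro r hr0 hr
    obtain ⟨B, hB0, hB⟩ := holder1 hη hr0 hr
    let cube : Set (Fin d → ℝ) := Set.univ.pi fun _ => Icc (0:ℝ) 1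
    let G : (Fin d → ℝ) → (Fin d → ℝ) := fun t i => pt (gd η (t i))
    have hGK : G '' cube ⊆ KK d η := by
      rintro _ ⟨t, _, rfl⟩
      exact KK_mem fun i => gd_sub η (t i)
    have hdist : ∀ a ∈ cube, ∀ b ∈ cube, dist a b ≤ B * dist (G a) (G b) ^ r := by
      intro a ha b hb
      rw [dist_pi_le_iff (by positivity)]
      intro i
      have h1 := hB (a i) (ha i (mem_univ i)) (b i) (hb i (mem_univ i))
      have h2 := dist_le_pi_dist (G a) (G b) i
      rw [Real.dist_eq] at h2 ⊢
      refine h1.trans ?_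
      gcongr
    have hinj : InjOn G cube := by
      intro a ha b hb hab
      have := hdist a ha b hb
      rw [hab, dist_self, Real.zero_rpow hr0.ne', mul_zero] at this
      exact dist_le_zero.1 this
    let F := Function.invFunOn G cube
    have hF : ∀ a ∈ cube, F (G a) = a := fun a ha => hinj.leftInvOn_invFunOn ha
    have himg : F '' (G '' cube) = cube := by
      rw [image_image]
      exact (image_congr hF).trans (image_id' cube)
    have hhol : HolderOnWith B.toNNReal r.toNNReal F (G '' cube) := by
      rintro _ ⟨a, ha, rfl⟩ _ ⟨b, hb, rfl⟩
      rw [hF a ha, hF b hb, edist_dist, edist_dist, Real.coe_toNNReal r hr0.le,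
        ENNReal.ofReal_rpow_of_nonneg dist_nonneg hr0.le]
      change _ ≤ ENNReal.ofReal B * _
      rw [← ENNReal.ofReal_mul hB0]
      exact ENNReal.ofReal_le_ofReal (hdist a ha b hb)
    have hd := hhol.dimH_image_le (Real.toNNReal_pos.2 hr0)
    rw [himg] at hd
    have hcube : dimH cube = d := by
      have : (interior cube).Nonempty := by
        rw [interior_pi_set finite_univ]
        refine ⟨fun _ => 1/2, fun i _ => ?_⟩
        rw [interior_Icc]
        constructor <;> norm_num
      rw [Real.dimH_of_nonempty_interior this]
      simp
    rw [hcube] at hd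
    have hr' : ((r.toNNReal : NNReal) : ℝ≥0∞) ≠ 0 := by
      have := Real.toNNReal_pos.2 hr0
      exact_mod_cast this.ne'
    rw [ENNReal.le_div_iff_mul_le (Or.inl hr') (Or.inl ENNReal.coe_ne_top)] at hd
    rw [ENNReal.ofReal_mul (by positivity), ENNReal.ofReal_natCast]
    exact hd.trans (dimH_mono hGK)
  have hlim : Tendsto (fun r : ℝ => ENNReal.ofReal (d * r)) (nhdsWithin α (Iio α))
      (nhds (ENNReal.ofReal (d * α))) := by
    apply tendsto_nhdsWithin_of_tendsto_nhds
    apply ENNReal.tendsto_ofReal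
    exact (continuous_const.mul continuous_id).tendsto α
  refine le_of_tendsto hlim ?_
  filter_upwards [Ioo_mem_nhdsLT h0] with r hr
  exact main r hr.1 hr.2

end Micro

namespace Micro

def cube (d : ℕ) : Set (Fin d → ℝ) := Set.univ.pi (fun _ => Set.Icc (0 : ℝ) 1)

section
variable {d : ℕ} {ω : ℕ → Bool} {E : Set (Fin d → ℝ)} {lam : ℕ → ℝ} {u : ℕ → Fin d → ℝ}
  {k : ℕ → ℕ} {η : ℕ → Bool}

lemma upper_cover
    (ht : Tendsto (fun n => Metric.hausdorffEDist
        (((fun z => lam n • z + u n) '' (KK d ω)) ∩ cube d) E) atTop (nhds 0))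
    (U : Ultrafilter ℕ) (hU : (U : Filter ℕ) ≤ atTop)
    (hk : ∀ n, 2^(k n) ≤ lam n ∧ lam n < 2^(k n + 1))
    (hη : ∀ m, ∀ᶠ n in (U : Filter ℕ), ω (k n + m) = η m) (j : ℕ) :
    ∃ T : Finset (Fin d → ℝ), T.card ≤ (3 * 2 ^ sm η (j+1))^d ∧
      E ⊆ ⋃ y ∈ T, Metric.closedBall y ((2 : ℝ) ^ (-(j : ℤ))) := by
  have h1 : ∀ᶠ n in (U : Filter ℕ), ∀ m ∈ Finset.range (j+1), ω (k n + m) = η m :=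
    (Filter.eventually_all_finset _).2 fun m _ => hη m
  have hpos : (0:ℝ) < (1/2)^(j+1) := by positivity
  have h2 : ∀ᶠ n in (U : Filter ℕ), Metric.hausdorffEDist
        (((fun z => lam n • z + u n) '' (KK d ω)) ∩ cube d) E < ENNReal.ofReal ((1/2)^(j+1)) :=
    hU (ht.eventually (gt_mem_nhds (ENNReal.ofReal_pos.2 hpos)))
  obtain ⟨n, h1, h2⟩ := (h1.and h2).exists
  obtain ⟨T, hT1, hT2⟩ := coverd d ω (k n) (j+1) (lam n) (u n) (hk n).1 (hk n).2
  refine ⟨T, ?_, ?_⟩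
  · rw [sm_congr (x := sh (k n) ω) (y := η) fun m hm => h1 m (Finset.mem_range.2 hm)] at hT1
    exact hT1
  · intro x hx
    rw [Metric.hausdorffEDist_comm] at h2
    obtain ⟨y, hy, hxy⟩ := Metric.exists_edist_lt_of_hausdorffEDist_lt hx h2
    obtain ⟨c, hc, hyc⟩ := hT2 y hy
    rw [edist_dist, ENNReal.ofReal_lt_ofReal_iff hpos] at hxy
    simp only [mem_iUnion]
    refine ⟨c, hc, ?_⟩
    rw [Metric.mem_closedBall, zp]
    have := dist_triangle x y c
    rw [pow_succ] at hxy hyc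
    linarith

lemma glue_sub {x y ω : ℕ → Bool} {N : ℕ} (hx : Sub x ω) (hy : ∀ m, y m = true → ω (N + m) = true) :
    Sub (fun m => if m < N then x m else y (m - N)) ω := by
  intro m hm
  by_cases h : m < N
  · simp only [h, if_true] at hm; exact hx m hm
  · simp only [h, if_false] at hm
    have := hy _ hm
    rwa [Nat.add_sub_cancel' (by omega)] at this

lemma glue_pt (x y : ℕ → Bool) (N : ℕ) :
    pt (fun m => if m < N then x m else y (m - N)) = (hd x N + pt y) / 2^N := by
  rw [pt_head _ N]
  have h1 : hd (fun m => if m < N then x m else y (m - N)) N = hd x N :=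
    hd_congr fun k hk => by simp [hk]
  have h2 : (fun k => (fun m => if m < N then x m else y (m - N)) (N + k)) = y := by
    funext k; simp
  rw [h1]
  congr 3

lemma lower_contain (hE : IsClosed E)
    (hne : (E ∩ Set.univ.pi (fun _ => Set.Ioo (0 : ℝ) 1)).Nonempty)
    (ht : Tendsto (fun n => Metric.hausdorffEDist
        (((fun z => lam n • z + u n) '' (KK d ω)) ∩ cube d) E) atTop (nhds 0))
    (U : Ultrafilter ℕ) (hU : (U : Filter ℕ) ≤ atTop)
    (hk : ∀ n, 2^(k n) ≤ lam n ∧ lam n < 2^(k n + 1))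
    (hη : ∀ m, ∀ᶠ n in (U : Filter ℕ), ω (k n + m) = η m) :
    ∃ (p : ℕ) (c : ℝ) (v : Fin d → ℝ), 0 < c ∧ (fun z => c • z + v) '' (KK d (sh p η)) ⊆ E := by
  obtain ⟨x, hxE, hx⟩ := hne
  have hopen : IsOpen (Set.univ.pi (fun _ : Fin d => Set.Ioo (0 : ℝ) 1)) :=
    isOpen_set_pi finite_univ fun _ _ => isOpen_Ioo
  obtain ⟨δ, hδ, hball⟩ := Metric.isOpen_iff.1 hopen x hx
  obtain ⟨p, hp⟩ := exists_pow_lt_of_lt_one (by positivity : 0 < δ/4) (by norm_num : (1/2:ℝ) < 1)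
  have h2 : ∀ᶠ n in (U : Filter ℕ), ∃ X : Fin d → ℕ → Bool, (∀ i, Sub (X i) ω) ∧
      dist x (fun i => lam n * pt (X i) + u n i) < δ/2 := by
    filter_upwards [hU (ht.eventually (gt_mem_nhds (ENNReal.ofReal_pos.2
      (by positivity : 0 < δ/2))))] with n hn
    rw [Metric.hausdorffEDist_comm] at hn
    obtain ⟨y, hy, hxy⟩ := Metric.exists_edist_lt_of_hausdorffEDist_lt hxE hn
    rw [edist_dist, ENNReal.ofReal_lt_ofReal_iff (by positivity)] at hxy
    obtain ⟨⟨z, hz, rfl⟩, hy⟩ := hy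
    obtain ⟨X, hX1, hX2⟩ := mem_KK hz
    refine ⟨X, hX1, ?_⟩
    convert hxy using 2
    funext i
    simp [hX2 i]
  obtain ⟨X, hX⟩ := Filter.skolem.1 h2
  obtain ⟨c, hc⟩ : ∃ c : ℕ → ℝ, ∀ n, c n = lam n / 2^(k n + p) := ⟨_, fun _ => rfl⟩
  obtain ⟨v, hv⟩ : ∃ v : ℕ → Fin d → ℝ, ∀ n i, v n i = c n * hd (X n i) (k n + p) + u n i :=
    ⟨_, fun _ _ => rfl⟩
  have hc1 : ∀ n, (1/2)^p ≤ c n := by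
    intro n
    rw [hc, le_div_iff₀ (by positivity), pow_add, one_div, inv_pow]
    have := (hk n).1
    field_simp
    exact this
  have hc2 : ∀ n, c n ≤ 2 * (1/2)^p := by
    intro n
    rw [hc, div_le_iff₀ (by positivity), pow_add, one_div, inv_pow]
    have := (hk n).2
    rw [pow_succ] at this
    field_simp
    linarith
  -- cell points
  have hcell : ∀ n i (y : ℕ → Bool),
      lam n * pt (fun m => if m < k n + p then X n i m else y (m - (k n + p))) + u n i
        = c n * pt y + v n i := by
    intro n i y
    rw [glue_pt, hv, hc]
    ring
  have hself : ∀ n i, lam n * pt (X n i) + u n i = c n * pt (sh (k n + p) (X n i)) + v n i := by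
    intro n i
    rw [pt_head (X n i) (k n + p), hv, hc]
    unfold sh
    ring
  have hclose : ∀ᶠ n in (U : Filter ℕ), ∀ i, |x i - v n i| ≤ δ := by
    filter_upwards [hX] with n hn i
    have h3 := (dist_pi_lt_iff (by positivity)).1 hn.2 i
    rw [hself, Real.dist_eq, abs_lt] at h3
    have a1 := pt_nonneg (sh (k n + p) (X n i))
    have a2 := pt_le_one (sh (k n + p) (X n i))
    have a3 := hc1 n
    have a4 := hc2 n
    have a5 : (0:ℝ) < (1/2)^p := by positivity
    rw [abs_le]
    constructor <;> nlinarith [h3.1, h3.2]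
  have hmem : ∀ᶠ n in (U : Filter ℕ), ∀ Y : Fin d → ℕ → Bool,
      (∀ i m, Y i m = true → ω (k n + p + m) = true) →
      (fun i => c n * pt (Y i) + v n i) ∈ ((fun z => lam n • z + u n) '' (KK d ω)) ∩ cube d := by
    filter_upwards [hX] with n hn Y hY
    constructor
    · refine ⟨_, KK_mem (X := fun i m => if m < k n + p then X n i m else Y i (m - (k n + p)))
        fun i => glue_sub (hn.1 i) (hY i), ?_⟩
      funext i
      simp only [Pi.add_apply, Pi.smul_apply, smul_eq_mul]
      exact hcell n i (Y i)
    · have : (fun i => c n * pt (Y i) + v n i) ∈ Metric.ball x δ := by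
        rw [Metric.mem_ball, dist_comm, dist_pi_lt_iff hδ]
        intro i
        have h3 := (dist_pi_lt_iff (by positivity)).1 hn.2 i
        rw [hself, Real.dist_eq, abs_lt] at h3
        have a1 := pt_nonneg (sh (k n + p) (X n i))
        have a2 := pt_le_one (sh (k n + p) (X n i))
        have b1 := pt_nonneg (Y i)
        have b2 := pt_le_one (Y i)
        have a3 := hc1 n
        have a4 := hc2 n
        have a5 : (0:ℝ) < (1/2)^p := by positivity
        rw [Real.dist_eq, abs_lt]
        constructor <;> nlinarith [h3.1, h3.2]
      have h4 := hball this
      intro i hi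
      exact Ioo_subset_Icc_self (h4 i hi)
  obtain ⟨c', hc'1, hc'2⟩ := (isCompact_Icc (a := (1/2:ℝ)^p) (b := 2 * (1/2)^p)).ultrafilter_le_nhds
    (U.map c) (by
      rw [le_principal_iff]
      exact Filter.mem_map.2 (Eventually.of_forall fun n => ⟨hc1 n, hc2 n⟩))
  obtain ⟨v', hv'1, hv'2⟩ := (isCompact_closedBall x δ).ultrafilter_le_nhds
    (U.map v) (by
      rw [le_principal_iff]
      refine Filter.mem_map.2 (hclose.mono fun n hn => ?_)
      show v n ∈ Metric.closedBall x δ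
      rw [Metric.mem_closedBall, dist_comm, dist_pi_le_iff hδ.le]
      exact hn)
  have hct : Tendsto c U (nhds c') := hc'2
  have hvt : Tendsto v U (nhds v') := hv'2
  refine ⟨p, c', v', lt_of_lt_of_le (by positivity) hc'1.1, ?_⟩
  rintro _ ⟨w, hw, rfl⟩
  obtain ⟨Y, hY1, hY2⟩ := mem_KK hw
  let Z : ℕ → Fin d → ℕ → Bool := fun n i m => Y i m && ω (k n + p + m)
  have hZ : ∀ i, Tendsto (fun n => Z n i) U (nhds (Y i)) := by
    intro i
    rw [tendsto_pi_nhds]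
    intro m
    refine tendsto_const_nhds.congr' ?_
    filter_upwards [hη (p + m)] with n hn
    simp only [Z]
    rw [add_assoc, hn]
    cases h : Y i m
    · rfl
    · have := hY1 i m h
      unfold sh at this
      rw [this]; rfl
  have hlim : Tendsto (fun n => (fun i => c n * pt (Z n i) + v n i)) U (nhds (c' • w + v')) := by
    rw [tendsto_pi_nhds]
    intro i
    have h5 := ((pt_cont.tendsto (Y i)).comp (hZ i))
    have h6 := (hct.mul h5).add ((tendsto_pi_nhds.1 hvt) i)
    simpa [hY2 i] using h6
  show c' • w + v' ∈ E
  rw [Metric.mem_iff_infEDist_zero_of_closed hE]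
  have h7 := (Metric.continuous_infEDist (s := E)).tendsto (c' • w + v')
  have h8 := h7.comp hlim
  refine tendsto_nhds_unique h8 ?_
  refine tendsto_of_tendsto_of_tendsto_of_le_of_le' tendsto_const_nhds (ht.mono_left hU)
    (Eventually.of_forall fun _ => bot_le) ?_
  filter_upwards [hmem] with n hn
  refine Metric.infEDist_le_hausdorffEDist_of_mem (hn (Z n) ?_)
  intro i m hm
  simp only [Z, Bool.and_eq_true] at hm
  exact hm.2

lemma dim_affine {c : ℝ} (hc : 0 < c) (v : Fin d → ℝ) (s : Set (Fin d → ℝ)) :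
    dimH s ≤ dimH ((fun z => c • z + v) '' s) := by
  refine AntilipschitzWith.le_dimH_image (K := (c⁻¹).toNNReal) ?_ s
  apply AntilipschitzWith.of_le_mul_dist
  intro a b
  rw [dist_add_right, dist_smul₀, Real.norm_of_nonneg hc.le, Real.coe_toNNReal _ (by positivity)]
  field_simp
  exact le_rfl

theorem main_claim (hE : IsCompact E)
    (hne : (E ∩ Set.univ.pi (fun _ => Set.Ioo (0 : ℝ) 1)).Nonempty)
    (ht : Tendsto (fun n => Metric.hausdorffEDist
        (((fun z => lam n • z + u n) '' (KK d ω)) ∩ cube d) E) atTop (nhds 0))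
    (U : Ultrafilter ℕ) (hU : (U : Filter ℕ) ≤ atTop)
    (hk : ∀ n, 2^(k n) ≤ lam n ∧ lam n < 2^(k n + 1))
    (hη : ∀ m, ∀ᶠ n in (U : Filter ℕ), ω (k n + m) = η m) {α : ℝ}
    (hα : Avg (fun m => bv (η m)) α) :
    dimH E = ENNReal.ofReal (d * α) ∧ ubDim E = ENNReal.ofReal (d * α) := by
  have hcov := upper_cover ht U hU hk hη
  have h1 : ubDim E ≤ ENNReal.ofReal (d * α) := ubDim_le d hα fun n => by
    obtain ⟨T, hT1, hT2⟩ := hcov n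
    exact (coverNum_le T hT2).trans hT1
  have h2 : dimH E ≤ ubDim E := dimH_le_ubDim fun n => by
    obtain ⟨T, hT1, hT2⟩ := hcov n
    exact ⟨T, hT2⟩
  have h3 : ENNReal.ofReal (d * α) ≤ dimH E := by
    obtain ⟨p, c, v, hc, hsub⟩ := lower_contain hE.isClosed hne ht U hU hk hη
    have h4 : Avg (fun m => bv (sh p η m)) α := by
      have := (avg_shift (f := fun m => bv (η m)) (fun n => by
        rw [abs_of_nonneg (bv_nonneg _)]; exact bv_le _) p).2 hα
      convert this using 4
      unfold sh
      rw [add_comm]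
    exact (dimH_KK h4).trans ((dim_affine hc v _).trans (dimH_mono hsub))
  exact ⟨le_antisymm (h2.trans h1) h3, le_antisymm h1 (h3.trans h2)⟩

end

end Micro

namespace Micro

lemma attain {d : ℕ} {ω : ℕ → Bool} {α : ℝ} {k : ℕ → ℕ}
    (hk : ∀ (U : Ultrafilter ℕ), (U : Filter ℕ) ≤ atTop → ∀ η : ℕ → Bool,
        (∀ m, ∀ᶠ n in (U : Filter ℕ), ω (k n + m) = η m) → Avg (fun m => bv (η m)) α) :
    ∃ E, IsMicroset d (KK d ω) E ∧ dimH E = ENNReal.ofReal (d * α) := by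
  have hcube : IsCompact (cube d) := isCompact_univ_pi fun _ => isCompact_Icc
  let u : Fin d → ℝ := fun _ => 1/4
  have hu : u ∈ Set.univ.pi (fun _ : Fin d => Set.Ioo (0 : ℝ) 1) := fun i _ => by
    simp only [u]; constructor <;> norm_num
  have hu' : u ∈ cube d := fun i hi => Ioo_subset_Icc_self (hu i hi)
  have h0 : (0 : Fin d → ℝ) ∈ KK d ω := by
    have := KK_mem (d := d) (ω := ω) (X := fun _ _ => false) (fun i m h => by cases h)
    convert this using 1
    funext i
    simp [pt, bv]
  have hA : ∀ n, IsCompact (((fun z => (2:ℝ)^(k n) • z + u) '' (KK d ω)) ∩ cube d) := fun n =>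
    ((KK_compact d ω).image (by fun_prop)).inter hcube
  let A : ℕ → TopologicalSpace.Compacts (Fin d → ℝ) := fun n => ⟨_, hA n⟩
  have hmem : ∀ n, A n ∈ {L : TopologicalSpace.Compacts (Fin d → ℝ) | ↑L ⊆ cube d} := fun n =>
    inter_subset_right
  obtain ⟨E, hE, φ, hφ, hlim⟩ := (TopologicalSpace.Compacts.isCompact_subsets_of_isCompact hcube).tendsto_subseq hmem
  have ht : Tendsto (fun n => Metric.hausdorffEDist
      (((fun z => (2:ℝ)^(k (φ n)) • z + u) '' (KK d ω)) ∩ cube d) (E : Set (Fin d → ℝ)))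
      atTop (nhds 0) := by
    have := tendsto_iff_edist_tendsto_0.1 hlim
    exact this
  have huE : u ∈ (E : Set (Fin d → ℝ)) := by
    rw [Metric.mem_iff_infEDist_zero_of_closed E.isCompact.isClosed]
    refine le_antisymm (ge_of_tendsto' ht fun n => ?_) bot_le
    refine Metric.infEDist_le_hausdorffEDist_of_mem ⟨⟨0, h0, ?_⟩, hu'⟩
    simp
  refine ⟨E, ⟨E.isCompact, hE, ⟨u, huE, hu⟩, fun n => (2:ℝ)^(k (φ n)), fun _ => u,
    fun n => one_le_pow₀ (by norm_num), ht⟩, ?_⟩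
  let V : Ultrafilter ℕ := hyperfilter ℕ
  have hV : (V : Filter ℕ) ≤ atTop := Nat.hyperfilter_le_atTop
  obtain ⟨η, hη⟩ := ult_lim V (fun n m => ω (k (φ n) + m))
  have hα := hk (V.map φ) (by
    rw [Ultrafilter.coe_map]
    exact (Filter.map_mono hV).trans hφ.tendsto_atTop) η (fun m => by
      rw [Ultrafilter.coe_map, Filter.eventually_map]; exact hη m)
  exact (main_claim (k := fun n => k (φ n)) E.isCompact ⟨u, huE, hu⟩ ht V hV
    (fun n => ⟨le_rfl, pow_lt_pow_right₀ (by norm_num) (by omega)⟩) hη hα).1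

end Micro

/-- If `A ⊆ [0,d]` is a nonempty analytic set containing its infimum and supremum, then
there is a compact set `K ⊆ ℝ^d` each of whose microsets has equal Hausdorff and upper box
dimensions, and whose microsets attain exactly the Hausdorff dimensions in `A`. -/
theorem statement1 (d : ℕ) (hd : 1 ≤ d) (A : Set ℝ) (hne : A.Nonempty)
    (hsub : A ⊆ Set.Icc 0 (d : ℝ)) (han : MeasureTheory.AnalyticSet A)
    (hinf : sInf A ∈ A) (hsup : sSup A ∈ A) :
    ∃ K : Set (Fin d → ℝ), IsCompact K ∧
      (∀ E, IsMicroset d K E → dimH E = ubDim E) ∧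
      {e : ℝ≥0∞ | ∃ E, IsMicroset d K E ∧ dimH E = e} = ENNReal.ofReal '' A := by
  have hd0 : (0:ℝ) < d := by exact_mod_cast hd
  have hcont : Continuous (fun y : ℝ => y / d) := by fun_prop
  have hmono : Monotone (fun y : ℝ => y / d) := fun a b h => by
    simp only; gcongr
  have hbb : BddBelow A := ⟨0, fun x hx => (hsub hx).1⟩
  have hba : BddAbove A := ⟨d, fun x hx => (hsub hx).2⟩
  have e1 : sInf ((fun y : ℝ => y / d) '' A) = sInf A / d :=
    (hmono.map_csInf_of_continuousAt hcont.continuousAt hne hbb).symm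
  have e2 : sSup ((fun y : ℝ => y / d) '' A) = sSup A / d :=
    (hmono.map_csSup_of_continuousAt hcont.continuousAt hne hba).symm
  obtain ⟨ω, h1, h2⟩ := Micro.comb (A := (fun y : ℝ => y / d) '' A) (hne.image _)
    (han.image_of_continuous hcont) (by
      rintro _ ⟨y, hy, rfl⟩
      have := hsub hy
      exact ⟨div_nonneg this.1 hd0.le, (div_le_one hd0).2 this.2⟩)
    (by rw [e1]; exact ⟨_, hinf, rfl⟩) (by rw [e2]; exact ⟨_, hsup, rfl⟩)
  have key : ∀ E, IsMicroset d (Micro.KK d ω) E → ∃ y ∈ A,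
      dimH E = ENNReal.ofReal y ∧ ubDim E = ENNReal.ofReal y := by
    rintro E ⟨hE1, hE2, hE3, lam, u, hlam, ht⟩
    have : ∀ n, ∃ k : ℕ, (2:ℝ)^k ≤ lam n ∧ lam n < 2^(k+1) := fun n =>
      exists_nat_pow_near (hlam n) (by norm_num)
    choose k hk using this
    obtain ⟨η, hη⟩ := Micro.ult_lim (hyperfilter ℕ) (fun n m => ω (k n + m))
    obtain ⟨_, ⟨y, hy, rfl⟩, hα⟩ := h1 (hyperfilter ℕ) k η hη
    have := Micro.main_claim hE1 hE3 ht (hyperfilter ℕ) Nat.hyperfilter_le_atTop hk hη hα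
    simp only [mul_div_cancel₀ y hd0.ne'] at this
    exact ⟨y, hy, this⟩
  refine ⟨Micro.KK d ω, Micro.KK_compact d ω, ?_, ?_⟩
  · intro E hE
    obtain ⟨y, _, h3, h4⟩ := key E hE
    rw [h3, h4]
  · ext e
    constructor
    · rintro ⟨E, hE, rfl⟩
      obtain ⟨y, hy, h3, _⟩ := key E hE
      exact ⟨y, hy, h3.symm⟩
    · rintro ⟨y, hy, rfl⟩
      obtain ⟨k, hk⟩ := h2 _ ⟨y, hy, rfl⟩
      obtain ⟨E, hE, h3⟩ := Micro.attain (d := d) hk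
      refine ⟨E, hE, ?_⟩
      rw [h3]
      simp only [mul_div_cancel₀ y hd0.ne']
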